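/- arXiv:2103.01137 — 6 statements merged into one kernel-verified Lean document; each statement's English description precedes it below -/
import Mathlib

section
/- Let G be a finite connected simple graph and let B be a partial orientation of G containing no directed cycle. If the divisor ∑_{d∈B} ∂d is principal (i.e., ∑_{d∈B} ∂d ∼ 0), then B is a disjoint union of directed cuts of G: there exist subsets S₁, …, S_r of the vertex set such that the directed cuts C(S₁), …, C(S_r) are pairwise disjoint and their union is B. -/
open Finset

variable {V : Type*}

/-- The divisor `∑_{d ∈ B} ∂d` associated to a set of darts `B`:
`∂(→uv)` takes value `+1` at `v`, `-1` at `u` and `0` elsewhere. -/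
def dartSumDiv [Fintype V] [DecidableEq V] (G : SimpleGraph V) (B : Finset G.Dart) :
    V → ℤ :=
  fun w => ∑ d ∈ B, ((if w = d.toProd.2 then (1 : ℤ) else 0) -
    (if w = d.toProd.1 then (1 : ℤ) else 0))

/-- A divisor is principal if it lies in the image of the Laplacian of `G`
acting on `ℤ`-valued functions on `V`. -/
def IsPrincipal [Fintype V] [DecidableEq V] (G : SimpleGraph V) [DecidableRel G.Adj]
    (D : V → ℤ) : Prop :=
  ∃ f : V → ℤ, ∀ w, D w = ∑ u ∈ G.neighborFinset w, (f w - f u)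

/-- `B` is a partial orientation: it contains at most one of the two darts of each edge. -/
def IsPartialOrientation (G : SimpleGraph V) (B : Finset G.Dart) : Prop :=
  ∀ d ∈ B, d.symm ∉ B

/-- `B` contains a directed cycle: darts `(v₀,v₁), (v₁,v₂), …, (v_{r−1},v₀)` with
distinct vertices all lie in `B`. -/
def HasDirectedCycle (G : SimpleGraph V) (B : Finset G.Dart) : Prop :=
  ∃ (r : ℕ) (v : Fin (r + 1) → V), Function.Injective v ∧
    ∀ i : Fin (r + 1), ∃ d ∈ B, d.toProd = (v i, v (i + 1))

/-- The directed cut determined by `S`: all darts of `G` going from `S` to its complement. -/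
def directedCut (G : SimpleGraph V) (S : Set V) : Set G.Dart :=
  {d | d.toProd.1 ∈ S ∧ d.toProd.2 ∉ S}

/-- A map on a nonempty finite type has an orbit that is a cycle of distinct points. -/
theorem exists_injective_cycle {α : Type*} [Finite α] [Nonempty α] (g : α → α) :
    ∃ (r : ℕ) (v : Fin (r + 1) → α), Function.Injective v ∧ ∀ i, g (v i) = v (i + 1) := by
  obtain ⟨a⟩ := ‹Nonempty α›
  obtain ⟨m, n, hmn, h⟩ : ∃ m n : ℕ, m < n ∧ g^[m] a = g^[n] a := by
    obtain ⟨m, n, hne, h⟩ := Finite.exists_ne_map_eq_of_infinite (fun n : ℕ => g^[n] a)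
    rcases lt_or_gt_of_ne hne with hlt | hlt
    exacts [⟨m, n, hlt, h⟩, ⟨n, m, hlt, h.symm⟩]
  set y := g^[m] a with hy
  have hper : Function.IsPeriodicPt g (n - m) y := by
    change g^[n - m] y = y
    rw [hy, ← Function.iterate_add_apply, Nat.sub_add_cancel hmn.le, ← h]
  have hpos := hper.minimalPeriod_pos (by omega)
  obtain ⟨r, hr⟩ := Nat.exists_eq_succ_of_ne_zero hpos.ne'
  refine ⟨r, fun i => g^[i.val] y, fun i j hij => ?_, fun i => ?_⟩
  · exact Fin.ext (Function.iterate_injOn_Iio_minimalPeriod (f := g) (x := y)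
      (by simp only [Set.mem_Iio]; omega) (by simp only [Set.mem_Iio]; omega) hij)
  · have hval : (i + 1).val = (i.val + 1) % Function.minimalPeriod g y := by
      rw [hr, Fin.val_add, Fin.val_one', Nat.add_mod_mod]
    simp only [hval, Function.iterate_mod_minimalPeriod_eq, Function.iterate_succ_apply']

/-- A nonempty relation on a finite type whose every edge can be continued contains a cycle. -/
theorem exists_injective_cycle_of_rel {α : Type*} [Finite α] {P : α → α → Prop}
    {u w : α} (huw : P u w) (hP : ∀ u w, P u w → ∃ v, P w v) :
    ∃ (r : ℕ) (v : Fin (r + 1) → α), Function.Injective v ∧ ∀ i, P (v i) (v (i + 1)) := by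
  choose g hg using fun x : {x // ∃ y, P x y} => x.2
  have : Nonempty {x // ∃ y, P x y} := ⟨⟨u, w, huw⟩⟩
  obtain ⟨r, v, hv, hcycle⟩ := exists_injective_cycle
    (fun x : {x // ∃ y, P x y} => (⟨g x, hP _ _ (hg x)⟩ : {x // ∃ y, P x y}))
  refine ⟨r, fun i => v i, Subtype.val_injective.comp hv, fun i => ?_⟩
  simpa only [← hcycle i] using hg (v i)

/-- An antisymmetric function on pairs with zero row sums is orthogonal to differences. -/
theorem sum_mul_sub_eq_zero_of_antisymm [Fintype V] {x : V → V → ℤ}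
    (hanti : ∀ u w, x u w = -x w u) (hsum : ∀ w, ∑ u, x u w = 0) (f : V → ℤ) :
    ∑ w, ∑ u, x u w * (f w - f u) = 0 := by
  have h₁ : ∑ w, ∑ u, x u w * f w = 0 := by simp [← Finset.sum_mul, hsum]
  have h₂ : ∑ w, ∑ u, x u w * f u = 0 := by
    rw [Finset.sum_comm, ← neg_eq_zero, ← h₁]
    simp only [← Finset.sum_neg_distrib]
    exact Finset.sum_congr rfl fun w _ => Finset.sum_congr rfl fun u _ => by
      rw [hanti u w]; ring
  simp only [mul_sub, Finset.sum_sub_distrib, h₁, h₂, sub_zero]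

open Classical in
/-- The indicator function of a set of darts, as a function on ordered pairs of vertices. -/
noncomputable def dartIndicator (G : SimpleGraph V) (B : Finset G.Dart) (u v : V) : ℤ :=
  if ∃ d ∈ B, d.toProd = (u, v) then 1 else 0

theorem dartIndicator_eq_sum [DecidableEq V] (G : SimpleGraph V) (B : Finset G.Dart) (u v : V) :
    dartIndicator G B u v = ∑ d ∈ B, if d.toProd = (u, v) then 1 else 0 := by
  classical
  unfold dartIndicator
  split_ifs with h
  · obtain ⟨d, hd, hduv⟩ := h
    rw [Finset.sum_eq_single_of_mem d hd, if_pos hduv]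
    intro e _ hne
    exact if_neg fun he => hne (SimpleGraph.Dart.ext (h := he.trans hduv.symm))
  · exact (Finset.sum_eq_zero fun d hd => if_neg fun hduv => h ⟨d, hd, hduv⟩).symm

theorem dartSumDiv_eq_sum_dartIndicator [Fintype V] [DecidableEq V] (G : SimpleGraph V)
    (B : Finset G.Dart) (w : V) :
    dartSumDiv G B w = ∑ u, (dartIndicator G B u w - dartIndicator G B w u) := by
  simp only [dartIndicator_eq_sum, Finset.sum_sub_distrib, dartSumDiv]
  congr 1
  · rw [Finset.sum_comm]
    refine Finset.sum_congr rfl fun d _ => ?_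
    simp [Prod.ext_iff, ite_and, eq_comm]
  · rw [Finset.sum_comm]
    refine Finset.sum_congr rfl fun d _ => ?_
    simp [Prod.ext_iff, ite_and, eq_comm]

/-- An acyclic set of darts with principal divisor is the gradient of a potential. -/
theorem exists_potential_of_isPrincipal [Fintype V] [DecidableEq V] (G : SimpleGraph V)
    [DecidableRel G.Adj] (B : Finset G.Dart) (hNoCycle : ¬ HasDirectedCycle G B)
    (hPrin : IsPrincipal G (dartSumDiv G B)) :
    ∃ f : V → ℤ, ∀ u w, G.Adj u w →
      dartIndicator G B u w - dartIndicator G B w u = f w - f u := by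
  classical
  obtain ⟨f, hf⟩ := hPrin
  have h_ind : ∀ u w, dartIndicator G B u w = 0 ∨ dartIndicator G B u w = 1 := by
    intro u w
    unfold dartIndicator
    split_ifs <;> simp
  have h_adj : ∀ u w, ¬ G.Adj u w → dartIndicator G B u w = 0 := by
    intro u w h
    refine if_neg ?_
    rintro ⟨d, -, hd⟩
    have := d.adj
    simp only [hd] at this
    exact h this
  set x : V → V → ℤ := fun u w =>
    dartIndicator G B u w - dartIndicator G B w u - if G.Adj w u then f w - f u else 0 with hx
  have hanti : ∀ u w, x u w = -x w u := by
    intro u w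
    simp only [hx, G.adj_comm u w]
    split_ifs <;> ring
  have hsum : ∀ w, ∑ u, x u w = 0 := by
    intro w
    have := hf w
    rw [dartSumDiv_eq_sum_dartIndicator, SimpleGraph.neighborFinset_eq_filter,
      Finset.sum_filter] at this
    simp only [hx]
    rw [Finset.sum_sub_distrib, this, sub_self]
  have hle : ∀ u w, x u w * (f w - f u) ≤ 0 := by
    intro u w
    by_cases h : G.Adj w u
    · simp only [hx, if_pos h]
      have h₁ : dartIndicator G B u w - dartIndicator G B w u ≤ 1 := by
        rcases h_ind u w with h | h <;> rcases h_ind w u with h' | h' <;> omega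
      have h₂ : -1 ≤ dartIndicator G B u w - dartIndicator G B w u := by
        rcases h_ind u w with h | h <;> rcases h_ind w u with h' | h' <;> omega
      rcases lt_trichotomy (f w - f u) 0 with h₃ | h₃ | h₃
      · exact mul_nonpos_of_nonneg_of_nonpos (by omega) h₃.le
      · simp [h₃]
      · exact mul_nonpos_of_nonpos_of_nonneg (by omega) h₃.le
    · simp [hx, h, h_adj w u h, h_adj u w fun h' => h h'.symm]
  have hzero : ∀ u w, x u w * (f w - f u) = 0 := by
    intro u w
    have h := sum_mul_sub_eq_zero_of_antisymm hanti hsum f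
    rw [Finset.sum_eq_zero_iff_of_nonpos fun w _ => Finset.sum_nonpos fun u _ => hle u w] at h
    exact (Finset.sum_eq_zero_iff_of_nonpos fun u _ => hle u w).1 (h w (mem_univ w)) u
      (mem_univ u)
  have hpos : ∀ u w, ¬ 0 < x u w := by
    intro u w huw
    obtain ⟨r, v, hv, hcycle⟩ := exists_injective_cycle_of_rel (P := fun u w => 0 < x u w) huw <| by
      intro u w huw
      by_contra! h
      refine (Finset.sum_pos' (fun v _ => ?_) ⟨u, mem_univ u, huw⟩).ne' (hsum w)
      have := h v
      have := hanti v w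
      omega
    refine hNoCycle ⟨r, v, hv, fun i => ?_⟩
    by_contra h
    have h₀ : dartIndicator G B (v i) (v (i + 1)) = 0 := if_neg h
    have hlt := hcycle i
    have heq : f (v (i + 1)) - f (v i) = 0 :=
      (mul_eq_zero.1 (hzero (v i) (v (i + 1)))).resolve_left hlt.ne'
    simp only [hx, h₀, heq, ite_self] at hlt
    rcases h_ind (v (i + 1)) (v i) with h' | h' <;> omega
  refine ⟨f, fun u w h => ?_⟩
  have h₁ := hpos u w
  have h₂ := hpos w u
  have h₃ := hanti u w
  have h₄ : x u w = 0 := by omega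
  simp only [hx, if_pos h.symm] at h₄
  omega

theorem lemma53_disjoint_union_of_cuts [Fintype V] [DecidableEq V]
    (G : SimpleGraph V) [DecidableRel G.Adj] (hG : G.Connected)
    (B : Finset G.Dart) (hPO : IsPartialOrientation G B)
    (hNoCycle : ¬ HasDirectedCycle G B)
    (hPrin : IsPrincipal G (dartSumDiv G B)) :
    ∃ (r : ℕ) (S : Fin r → Set V),
      (∀ i j : Fin r, i ≠ j → Disjoint (directedCut G (S i)) (directedCut G (S j))) ∧
      (⋃ i : Fin r, directedCut G (S i)) = (↑B : Set G.Dart) := by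
  classical
  obtain ⟨f, hf⟩ := exists_potential_of_isPrincipal G B hNoCycle hPrin
  have h_mem : ∀ d : G.Dart, dartIndicator G B d.fst d.snd = if d ∈ B then 1 else 0 := by
    intro d
    have : (∃ e ∈ B, e.toProd = (d.fst, d.snd)) ↔ d ∈ B := by
      refine ⟨?_, fun h => ⟨d, h, rfl⟩⟩
      rintro ⟨e, he, hed⟩
      rwa [← SimpleGraph.Dart.ext (h := hed)]
    simp only [dartIndicator, this]
  have h_diff : ∀ d : G.Dart,
      ((if d ∈ B then 1 else 0) - if d.symm ∈ B then 1 else 0) = f d.snd - f d.fst := by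
    intro d
    rw [← hf _ _ d.adj, ← h_mem d, ← h_mem d.symm]
    rfl
  have h_step : ∀ d : G.Dart, f d.snd ≤ f d.fst + 1 := by
    intro d
    have := h_diff d
    split_ifs at this <;> omega
  have h_iff : ∀ d : G.Dart, d ∈ B ↔ f d.fst < f d.snd := by
    intro d
    have := h_diff d
    have := hPO d
    split_ifs at * <;> simp_all <;> omega
  let e := (univ.image f).equivFin
  refine ⟨#(univ.image f), fun i => {u | f u ≤ (e.symm i : ℤ)}, fun i j hij => ?_, ?_⟩
  · rw [Set.disjoint_left]
    rintro d ⟨h₁, h₂⟩ ⟨h₃, h₄⟩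
    simp only [Set.mem_ofPred_eq, not_le] at h₁ h₂ h₃ h₄
    have := h_step d
    exact hij (e.symm.injective (Subtype.ext (by omega)))
  · ext d
    simp only [Set.mem_iUnion, directedCut, Set.mem_ofPred_eq, not_le, mem_coe, h_iff]
    constructor
    · rintro ⟨i, h₁, h₂⟩
      exact h₁.trans_lt h₂
    · intro h
      exact ⟨e ⟨f d.fst, mem_image_of_mem f (mem_univ _)⟩, by simp, by simpa using h⟩
end

section
/- Let G be a finite connected simple graph and let B be a partial orientation of G containing no directed cycle such that the divisor ∑_{d∈B} ∂d is principal. If B contains at least one dart, then B contains a directed cut: there exists a nonempty proper subset S of the vertex set such that every edge of G with exactly one endpoint in S, oriented from S to its complement, is a dart of B. -/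
open Finset

variable {V : Type*}

/-- A relation on a nonempty finite set in which every target of the relation is again a source
contains a cycle with distinct vertices. -/
theorem exists_injective_cycle_s1 [Finite V] {R : V → V → Prop} {x y : V} (hxy : R x y)
    (hR : ∀ a b, R a b → ∃ c, R b c) :
    ∃ (r : ℕ) (v : Fin (r + 1) → V), Function.Injective v ∧ ∀ i, R (v i) (v (i + 1)) := by
  classical
  have hnext : ∀ a, ∃ b, (∃ c, R a c) → R a b := fun a => by
    by_cases h : ∃ c, R a c
    · exact h.imp fun b hb _ => hb
    · exact ⟨a, fun h' => absurd h' h⟩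
  choose next hnext using hnext
  have hiter : ∀ n, R (next^[n] x) (next^[n + 1] x) := by
    intro n
    induction n with
    | zero => exact hnext x ⟨y, hxy⟩
    | succ n ih =>
      rw [Function.iterate_succ_apply' next (n + 1)]
      exact hnext _ (hR _ _ ih)
  obtain ⟨m, n, hmn, heq⟩ : ∃ m n, m < n ∧ next^[m] x = next^[n] x := by
    obtain ⟨m, n, hne, heq⟩ := Finite.exists_ne_map_eq_of_infinite fun n : ℕ => next^[n] x
    rcases lt_or_gt_of_ne hne with h | h
    · exact ⟨m, n, h, heq⟩
    · exact ⟨n, m, h, heq.symm⟩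
  set z := next^[m] x with hz
  have hper : Function.IsPeriodicPt next (n - m) z := by
    change next^[n - m] z = z
    rw [hz, ← Function.iterate_add_apply, Nat.sub_add_cancel hmn.le]
    exact heq.symm
  have hpos : 0 < Function.minimalPeriod next z :=
    hper.minimalPeriod_pos (Nat.sub_pos_of_lt hmn)
  obtain ⟨r, hr⟩ := Nat.exists_eq_succ_of_ne_zero hpos.ne'
  refine ⟨r, fun i => next^[i] z, fun i j hij => ?_, fun i => ?_⟩
  · refine Fin.ext (Function.iterate_injOn_Iio_minimalPeriod ?_ ?_ hij)
    · simpa [hr] using i.is_lt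
    · simpa [hr] using j.is_lt
  · have hsucc : next^[(i + 1 : Fin (r + 1))] z = next^[(i : ℕ) + 1] z := by
      rw [Fin.val_add, Fin.val_one', Nat.add_mod_mod]
      simpa only [hr] using
        Function.iterate_mod_minimalPeriod_eq (f := next) (x := z) (n := i + 1)
    change R (next^[i] z) (next^[(i + 1 : Fin (r + 1))] z)
    rw [hsucc, hz, ← Function.iterate_add_apply, ← Function.iterate_add_apply,
      Nat.add_right_comm]
    exact hiter _

/-- If in-degrees and out-degrees of a nonempty set of darts agree at every vertex, then it
contains a directed cycle. -/
theorem hasDirectedCycle_of_dartSumDiv_eq_zero [Fintype V] [DecidableEq V] {G : SimpleGraph V}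
    {B : Finset G.Dart} (hB : B.Nonempty) (hD : ∀ w, dartSumDiv G B w = 0) :
    HasDirectedCycle G B := by
  obtain ⟨d, hd⟩ := hB
  refine exists_injective_cycle_s1 (R := fun a b => ∃ d ∈ B, d.toProd = (a, b))
    ⟨d, hd, rfl⟩ ?_
  rintro a b ⟨e, he, hab⟩
  by_contra! hb
  have hpos : 0 < dartSumDiv G B b := by
    have hout : ∀ d ∈ B, b ≠ d.toProd.1 := fun d hd h =>
      hb d.toProd.2 d hd (Prod.ext h.symm rfl)
    refine Finset.sum_pos' (fun d hd => ?_) ⟨e, he, ?_⟩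
    · rw [if_neg (hout d hd)]
      split_ifs <;> simp
    · rw [if_neg (hout e he), if_pos (by rw [hab])]
      simp
  exact hpos.ne' (hD b)

/-- The degree of `∑_{d ∈ B} ∂d` on `S` counts darts of `B` by whether they end or start in `S`. -/
theorem sum_dartSumDiv [Fintype V] [DecidableEq V] (G : SimpleGraph V) (B : Finset G.Dart)
    (S : Finset V) :
    ∑ w ∈ S, dartSumDiv G B w =
      ∑ d ∈ B, ((if d.toProd.2 ∈ S then (1 : ℤ) else 0) - if d.toProd.1 ∈ S then 1 else 0) := by
  simp only [dartSumDiv]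
  rw [Finset.sum_comm]
  simp [Finset.sum_sub_distrib]

/-- A sum over the neighbors of the vertices in `S` is a sum over the darts starting in `S`. -/
theorem sum_sum_neighborFinset [Fintype V] [DecidableEq V] (G : SimpleGraph V)
    [DecidableRel G.Adj] {M : Type*} [AddCommMonoid M] (S : Finset V) (g : V → V → M) :
    ∑ w ∈ S, ∑ u ∈ G.neighborFinset w, g w u =
      ∑ d : G.Dart with d.toProd.1 ∈ S, g d.toProd.1 d.toProd.2 := by
  rw [Finset.sum_sigma']
  refine Finset.sum_bij'
    (fun p hp => (⟨(p.1, p.2), by simpa using (Finset.mem_sigma.1 hp).2⟩ : G.Dart))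
    (fun d _ => ⟨d.toProd.1, d.toProd.2⟩) ?_ ?_ ?_ ?_ ?_
  · intro p hp
    simpa using (Finset.mem_sigma.1 hp).1
  · intro d hd
    simpa [d.adj] using hd
  all_goals intros; rfl

/-- The set where a potential of `∑_{d ∈ B} ∂d` is minimal determines a directed cut inside `B`. -/
theorem directedCut_subset_of_forall_le [Fintype V] [DecidableEq V] {G : SimpleGraph V}
    [DecidableRel G.Adj] {B : Finset G.Dart} {f : V → ℤ}
    (hf : ∀ w, dartSumDiv G B w = ∑ u ∈ G.neighborFinset w, (f w - f u))
    {x : V} (hx : ∀ y, f x ≤ f y) :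
    directedCut G {w | f w = f x} ⊆ (↑B : Set G.Dart) := by
  set S : Finset V := {w | f w = f x} with hS
  set C : Finset G.Dart := {d | d.toProd.1 ∈ S ∧ d.toProd.2 ∉ S} with hC
  have hupper : ∑ w ∈ S, dartSumDiv G B w ≤ -(#C : ℤ) := by
    rw [Finset.sum_congr rfl fun w _ => hf w, sum_sum_neighborFinset G S fun w u => f w - f u,
      hC, Finset.card_filter, Finset.sum_filter]
    push_cast
    rw [← Finset.sum_neg_distrib]
    refine Finset.sum_le_sum fun d _ => ?_
    have h1 := hx d.toProd.1
    have h2 := hx d.toProd.2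
    simp only [hS, Finset.mem_filter, Finset.mem_univ, true_and]
    split_ifs <;> omega
  have hlower : -(#(B ∩ C) : ℤ) ≤ ∑ w ∈ S, dartSumDiv G B w := by
    rw [sum_dartSumDiv, ← Finset.filter_mem_eq_inter, Finset.card_filter]
    push_cast
    rw [← Finset.sum_neg_distrib]
    refine Finset.sum_le_sum fun d _ => ?_
    simp only [hC, Finset.mem_filter, Finset.mem_univ, true_and]
    split_ifs <;> simp_all
  have hinter : B ∩ C = C :=
    Finset.eq_of_subset_of_card_le Finset.inter_subset_right (by omega)
  intro d hd
  have hdC : d ∈ C := by simpa [hC, hS, directedCut] using hd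
  exact Finset.inter_subset_left (hinter.symm ▸ hdC)

theorem lemma53_contains_directed_cut [Fintype V] [DecidableEq V]
    (G : SimpleGraph V) [DecidableRel G.Adj] (hG : G.Connected)
    (B : Finset G.Dart) (hPO : IsPartialOrientation G B)
    (hNoCycle : ¬ HasDirectedCycle G B)
    (hPrin : IsPrincipal G (dartSumDiv G B))
    (hNe : B.Nonempty) :
    ∃ S : Set V, S.Nonempty ∧ S ≠ Set.univ ∧ directedCut G S ⊆ (↑B : Set G.Dart) := by
  obtain ⟨f, hf⟩ := hPrin
  have := hG.nonempty
  obtain ⟨x, hx⟩ := Finite.exists_min f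
  refine ⟨{w | f w = f x}, ⟨x, rfl⟩, fun huniv => hNoCycle ?_,
    directedCut_subset_of_forall_le hf hx⟩
  have hconst : ∀ w, f w = f x := Set.eq_univ_iff_forall.1 huniv
  refine hasDirectedCycle_of_dartSumDiv_eq_zero hNe fun w => ?_
  rw [hf]
  exact Finset.sum_eq_zero fun u _ => by rw [hconst w, hconst u, sub_self]
end

section
/- Let G be a finite connected simple graph, let T be a spanning tree of G, and let B be a nonempty partial orientation of G containing no directed cycle such that no edge underlying a dart of B is an edge of T. Then the divisor ∑_{d∈B} ∂d is not principal, i.e., ∑_{d∈B} ∂d ≁ 0. -/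
open Finset

variable {V : Type*}

theorem sum_mul_dartSumDiv [Fintype V] [DecidableEq V] (G : SimpleGraph V)
    (B : Finset G.Dart) (f : V → ℤ) :
    ∑ w, f w * dartSumDiv G B w = ∑ d ∈ B, (f d.toProd.2 - f d.toProd.1) := by
  simp only [dartSumDiv, mul_sum]
  rw [sum_comm]
  simp [mul_sub]

/-- If the Laplacian of `f` is the divisor of a set of darts `B`, then `f` is constant along every
edge of `G` not underlying a dart of `B`. -/
theorem eq_of_adj_of_dartSumDiv_eq [Fintype V] [DecidableEq V] (G : SimpleGraph V)
    [DecidableRel G.Adj] (B : Finset G.Dart) (f : V → ℤ)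
    (hf : ∀ w, dartSumDiv G B w = ∑ u ∈ G.neighborFinset w, (f w - f u))
    {x y : V} (hxy : G.Adj x y) (hB : ∀ d ∈ B, d.toProd ≠ (x, y) ∧ d.toProd ≠ (y, x)) :
    f x = f y := by
  set P : Finset (V × V) := B.image (fun d => d.toProd) with hP
  have hPG : ∀ u w, (u, w) ∈ P → G.Adj u w := by
    intro u w h
    obtain ⟨d, -, hd⟩ := mem_image.1 h
    have := d.adj
    rwa [hd] at this
  let q : V → V → ℤ := fun w u =>
    (if G.Adj w u then f w * (f w - f u) else 0) - (if (w, u) ∈ P then f u - f w else 0)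
  have hq : ∑ w, ∑ u, q w u = 0 := by
    have h1 : ∑ w, ∑ u, (if G.Adj w u then f w * (f w - f u) else 0) =
        ∑ w, f w * dartSumDiv G B w := by
      refine sum_congr rfl fun w _ => ?_
      rw [hf, mul_sum, ← sum_filter, SimpleGraph.neighborFinset_eq_filter]
    have h2 : ∑ w, ∑ u, (if (w, u) ∈ P then f u - f w else 0) =
        ∑ d ∈ B, (f d.toProd.2 - f d.toProd.1) := by
      rw [← Fintype.sum_prod_type' (fun w u => if (w, u) ∈ P then f u - f w else 0)]
      simp only [Prod.mk.eta, sum_ite_mem, univ_inter, hP]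
      exact sum_image fun a _ b _ h => SimpleGraph.Dart.ext _ _ h
    simp only [q, sum_sub_distrib]
    rw [h1, h2, sum_mul_dartSumDiv, sub_self]
  have hq' : ∑ w, ∑ u, (q w u + q u w) = 0 := by
    simp only [sum_add_distrib]
    rw [sum_comm (f := fun w u => q u w), hq, add_zero]
  have hnn : ∀ w u, 0 ≤ q w u + q u w := by
    intro w u
    have hsq := Int.le_self_sq (f w - f u)
    have hsq' := Int.le_self_sq (f u - f w)
    have h1 := hPG w u
    have h2 := hPG u w
    simp only [q, G.adj_comm u w] at *
    by_cases ha : G.Adj w u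
    · simp only [ha, if_true]
      split_ifs <;> nlinarith
    · have n1 : (w, u) ∉ P := fun h => ha (h1 h)
      have n2 : (u, w) ∉ P := fun h => ha (h2 h)
      simp [ha, n1, n2]
  have hz : q x y + q y x = 0 := by
    have h := (sum_eq_zero_iff_of_nonneg fun w _ => sum_nonneg fun u _ => hnn w u).1 hq' x
      (mem_univ x)
    exact (sum_eq_zero_iff_of_nonneg fun u _ => hnn x u).1 h y (mem_univ y)
  have n1 : (x, y) ∉ P := fun h => by
    obtain ⟨d, hd, e⟩ := mem_image.1 h
    exact (hB d hd).1 e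
  have n2 : (y, x) ∉ P := fun h => by
    obtain ⟨d, hd, e⟩ := mem_image.1 h
    exact (hB d hd).2 e
  simp only [q, hxy, hxy.symm, n1, n2, if_true, if_false] at hz
  have : (f x - f y) ^ 2 = 0 := by linarith
  exact sub_eq_zero.1 (pow_eq_zero_iff two_ne_zero |>.1 this)

theorem exists_dart_fst_eq_of_dartSumDiv_eq_zero [Fintype V] [DecidableEq V]
    (G : SimpleGraph V) (B : Finset G.Dart) (h0 : ∀ w, dartSumDiv G B w = 0)
    {d : G.Dart} (hd : d ∈ B) : ∃ e ∈ B, e.toProd.1 = d.toProd.2 := by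
  by_contra! hne
  have h := h0 d.toProd.2
  have hnn : ∀ e ∈ B, 0 ≤ ((if d.toProd.2 = e.toProd.2 then (1 : ℤ) else 0) -
      (if d.toProd.2 = e.toProd.1 then (1 : ℤ) else 0)) := by
    intro e he
    rw [if_neg (hne e he).symm]
    split_ifs <;> simp
  have := (sum_eq_zero_iff_of_nonneg hnn).1 h d hd
  rw [if_neg (hne d hd).symm] at this
  simp at this

theorem hasDirectedCycle_of_forall_exists_dart [Finite V] (G : SimpleGraph V)
    (B : Finset G.Dart) (hNe : B.Nonempty)
    (hB : ∀ d ∈ B, ∃ e ∈ B, e.toProd.1 = d.toProd.2) : HasDirectedCycle G B := by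
  classical
  have hnext : ∀ v, ∃ w, (∃ d ∈ B, d.toProd.1 = v) → ∃ d ∈ B, d.toProd = (v, w) := by
    intro v
    by_cases h : ∃ d ∈ B, d.toProd.1 = v
    · obtain ⟨d, hd, rfl⟩ := h
      exact ⟨d.toProd.2, fun _ => ⟨d, hd, rfl⟩⟩
    · exact ⟨v, fun h' => absurd h' h⟩
  choose g hg using hnext
  obtain ⟨d₀, hd₀⟩ := hNe
  have hout : ∀ n, ∃ d ∈ B, d.toProd.1 = g^[n] d₀.toProd.1 := by
    intro n
    induction n with
    | zero => exact ⟨d₀, hd₀, rfl⟩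
    | succ n ih =>
      obtain ⟨d, hd, e⟩ := hg _ ih
      obtain ⟨d', hd', e'⟩ := hB d hd
      exact ⟨d', hd', by rw [e', e, Function.iterate_succ_apply']⟩
  obtain ⟨m, n, hmn, heq⟩ : ∃ m n, m < n ∧ g^[m] d₀.toProd.1 = g^[n] d₀.toProd.1 := by
    obtain ⟨m, n, hne, h⟩ := Finite.exists_ne_map_eq_of_infinite fun n : ℕ => g^[n] d₀.toProd.1
    rcases hne.lt_or_gt with hlt | hlt
    · exact ⟨m, n, hlt, h⟩
    · exact ⟨n, m, hlt, h.symm⟩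
  set y := g^[m] d₀.toProd.1 with hy
  have hper : Function.IsPeriodicPt g (n - m) y := by
    change g^[n - m] y = y
    rw [hy, ← Function.iterate_add_apply, Nat.sub_add_cancel hmn.le]
    exact heq.symm
  have hpos := hper.minimalPeriod_pos (by omega)
  obtain ⟨r, hr⟩ : ∃ r, Function.minimalPeriod g y = r + 1 :=
    ⟨_, (Nat.succ_pred_eq_of_pos hpos).symm⟩
  have hlt : ∀ i : Fin (r + 1), (i : ℕ) ∈ Set.Iio (Function.minimalPeriod g y) := fun i => by
    rw [hr]
    exact i.isLt
  refine ⟨r, fun i => g^[i] y, fun i j hij => ?_, fun i => ?_⟩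
  · exact Fin.ext (Function.iterate_injOn_Iio_minimalPeriod (hlt i) (hlt j) hij)
  · have hsucc : g^[((i + 1 : Fin (r + 1)) : ℕ)] y = g (g^[(i : ℕ)] y) := by
      rw [← Function.iterate_succ_apply' g, Fin.val_add_one]
      split_ifs with h
      · subst h
        have := Function.iterate_minimalPeriod (f := g) (x := y)
        rw [hr] at this
        simpa using this.symm
      · rfl
    simp only [hsucc]
    apply hg
    rw [hy, ← Function.iterate_add_apply]
    exact hout _

theorem not_principal_of_disjoint_from_spanning_tree [Fintype V] [DecidableEq V]
    (G : SimpleGraph V) [DecidableRel G.Adj] (hG : G.Connected)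
    (T : SimpleGraph V) (hTG : T ≤ G) (hT : T.IsTree)
    (B : Finset G.Dart) (hPO : IsPartialOrientation G B)
    (hNe : B.Nonempty)
    (hNoCycle : ¬ HasDirectedCycle G B)
    (hDisj : ∀ d ∈ B, ¬ T.Adj d.toProd.1 d.toProd.2) :
    ¬ IsPrincipal G (dartSumDiv G B) := by
  rintro ⟨f, hf⟩
  have hadj : ∀ x y, T.Adj x y → f x = f y := fun x y h =>
    eq_of_adj_of_dartSumDiv_eq G B f hf (hTG h) fun d hd =>
      ⟨fun e => hDisj d hd (by rw [e]; exact h), fun e => hDisj d hd (by rw [e]; exact h.symm)⟩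
  have hwalk : ∀ x y, T.Walk x y → f x = f y := by
    intro x y p
    induction p with
    | nil => rfl
    | cons h _ ih => exact (hadj _ _ h).trans ih
  have hconst : ∀ x y, f x = f y := fun x y => (hT.connected x y).elim (hwalk x y)
  have h0 : ∀ w, dartSumDiv G B w = 0 := fun w => by
    rw [hf]
    exact sum_eq_zero fun u _ => sub_eq_zero.2 (hconst w u)
  exact hNoCycle (hasDirectedCycle_of_forall_exists_dart G B hNe fun d hd =>
    exists_dart_fst_eq_of_dartSumDiv_eq_zero G B h0 hd)
end

section
/- Let the finite connected simple graph G be the wedge sum G₁ ∨_c G₂ of connected subgraphs G₁ and G₂ at a vertex c. Then the map sending a pair (D₁, D₂) ∈ Div⁰(G₁) ⊕ Div⁰(G₂) (each divisor extended by zero to all of V(G)) to the linear equivalence class of D₁ + D₂ in Pic⁰(G) induces a group isomorphism Pic⁰(G₁) ⊕ Pic⁰(G₂) ≅ Pic⁰(G). -/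
open Finset

variable {V : Type*}

/-- The degree homomorphism on divisors. -/
def degHom (W : Type*) [Fintype W] : (W → ℤ) →+ ℤ where
  toFun D := ∑ w, D w
  map_zero' := by simp
  map_add' a b := by simp [Finset.sum_add_distrib]

/-- `Div⁰`: the group of divisors of degree `0`. -/
def Div0 (W : Type*) [Fintype W] : AddSubgroup (W → ℤ) := (degHom W).ker

/-- `Prin`: the group of principal divisors, generated by the divisors
`∑_{u adjacent to v} ∂(→uv)` for `v ∈ W`. -/
def Prin (W : Type*) [Fintype W] [DecidableEq W] (H : SimpleGraph W) [DecidableRel H.Adj] :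
    AddSubgroup (W → ℤ) :=
  AddSubgroup.closure
    {D | ∃ v : W, D = fun w => ∑ u ∈ H.neighborFinset v,
      ((if w = v then (1 : ℤ) else 0) - (if w = u then (1 : ℤ) else 0))}

/-- The Picard group `Pic⁰ = Div⁰/Prin`. -/
abbrev Pic (W : Type*) [Fintype W] [DecidableEq W] (H : SimpleGraph W) [DecidableRel H.Adj] :=
  ↥(Div0 W) ⧸ (Prin W H).addSubgroupOf (Div0 W)

/-- Extension of a divisor on a subset of vertices by zero. -/
def extendZero [DecidableEq V] (V₁ : Set V) [DecidablePred (· ∈ V₁)] (D : ↥V₁ → ℤ) :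
    V → ℤ :=
  fun v => if h : v ∈ V₁ then D ⟨v, h⟩ else 0

lemma sum_extendZero [Fintype V] [DecidableEq V] (V₁ : Set V) [DecidablePred (· ∈ V₁)]
    (D : ↥V₁ → ℤ) : ∑ v : V, extendZero V₁ D v = ∑ v : ↥V₁, D v := by
  classical
  have h1 : ∑ x ∈ Finset.univ.filter (· ∈ V₁), extendZero V₁ D x
      = ∑ a : ↥V₁, extendZero V₁ D ↑a :=
    Finset.sum_subtype _ (by simp) _
  have h2 : ∑ v : V, extendZero V₁ D v
      = ∑ x ∈ Finset.univ.filter (· ∈ V₁), extendZero V₁ D x := by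
    refine (Finset.sum_subset (Finset.subset_univ _) ?_).symm
    intro x _ hx
    simp only [Finset.mem_filter, Finset.mem_univ, true_and] at hx
    simp [extendZero, hx]
  rw [h2, h1]
  exact Finset.sum_congr rfl (fun x _ => by simp [extendZero, x.2])

lemma extendZero_add_mem [Fintype V] [DecidableEq V]
    (V₁ V₂ : Set V) [DecidablePred (· ∈ V₁)] [DecidablePred (· ∈ V₂)]
    (D₁ : ↥(Div0 ↥V₁)) (D₂ : ↥(Div0 ↥V₂)) :
    extendZero V₁ (D₁ : ↥V₁ → ℤ) + extendZero V₂ (D₂ : ↥V₂ → ℤ) ∈ Div0 V := by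
  have h1 := D₁.2
  have h2 := D₂.2
  simp only [Div0, AddMonoidHom.mem_ker, degHom, AddMonoidHom.coe_mk, ZeroHom.coe_mk] at h1 h2 ⊢
  simp only [Pi.add_apply, Finset.sum_add_distrib, sum_extendZero, h1, h2, add_zero]

section Pushforward

variable {X Y Z : Type*} [Fintype X] [Fintype Y] [Fintype Z]

/-- Pushforward of divisors along a map of vertex sets. -/
noncomputable def pushforward (f : X → Y) : (X → ℤ) →+ (Y → ℤ) :=
  (FunOnFinite.linearMap ℤ ℤ f).toAddMonoidHom

lemma pushforward_apply [DecidableEq Y] (f : X → Y) (D : X → ℤ) (y : Y) :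
    pushforward f D y = ∑ x, if f x = y then D x else 0 := by
  rw [← Finset.sum_filter]
  exact FunOnFinite.linearMap_apply_apply ℤ ℤ f D y

lemma pushforward_single [DecidableEq X] [DecidableEq Y] (f : X → Y) (x : X) (n : ℤ) :
    pushforward f (Pi.single x n) = Pi.single (f x) n :=
  FunOnFinite.linearMap_piSingle ℤ ℤ f x n

lemma pushforward_id (D : X → ℤ) : pushforward id D = D := by
  simp [pushforward, FunOnFinite.linearMap_id]

lemma pushforward_pushforward (g : Y → Z) (f : X → Y) (D : X → ℤ) :
    pushforward g (pushforward f D) = pushforward (g ∘ f) D := by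
  simp [pushforward, FunOnFinite.linearMap_comp]

lemma degHom_pushforward (f : X → Y) (D : X → ℤ) :
    degHom Y (pushforward f D) = degHom X D := by
  classical
  simp only [degHom, AddMonoidHom.coe_mk, ZeroHom.coe_mk, pushforward_apply]
  rw [Finset.sum_comm]
  simp

lemma pushforward_const {D : X → ℤ} (hD : D ∈ Div0 X) (y : Y) :
    pushforward (fun _ => y) D = 0 := by
  classical
  have h : ∑ x, D x = 0 := hD
  ext w
  by_cases hw : y = w <;> simp [pushforward_apply, hw, h]

/-- If two self-maps of `X` each fix the points that the other one retractTos to `c`, their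
pushforwards add up to the identity on divisors of degree `0`. -/
lemma pushforward_add_pushforward {f g : X → X} {c : X}
    (h : ∀ x, (f x = x ∧ g x = c) ∨ (f x = c ∧ g x = x)) {D : X → ℤ} (hD : D ∈ Div0 X) :
    pushforward f D + pushforward g D = D := by
  classical
  have key : pushforward f D + pushforward g D
      = pushforward id D + pushforward (fun _ => c) D := by
    ext w
    simp only [Pi.add_apply, pushforward_apply, ← Finset.sum_add_distrib]
    refine Finset.sum_congr rfl fun x _ => ?_
    rcases h x with ⟨hf, hg⟩ | ⟨hf, hg⟩
    · simp [hf, hg]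
    · simp [hf, hg, add_comm]
  rw [key, pushforward_id, pushforward_const hD, add_zero]

/-- Pushforward of divisors of degree `0`. -/
noncomputable def div0Map (f : X → Y) : ↥(Div0 X) →+ ↥(Div0 Y) :=
  ((pushforward f).comp (Div0 X).subtype).codRestrict (Div0 Y) fun D =>
    (degHom_pushforward f D.1).trans D.2

lemma coe_div0Map (f : X → Y) (D : ↥(Div0 X)) :
    (div0Map f D : Y → ℤ) = pushforward f D := rfl

variable [DecidableEq X] [DecidableEq Y]
  {H : SimpleGraph X} [DecidableRel H.Adj] {K : SimpleGraph Y} [DecidableRel K.Adj]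

/-- The map of Picard groups induced by a map of vertex sets whose pushforward preserves
principal divisors. -/
noncomputable def picMap (f : X → Y) (hf : Prin X H ≤ (Prin Y K).comap (pushforward f)) :
    Pic X H →+ Pic Y K :=
  QuotientAddGroup.map _ _ (div0Map f) fun _ hD => hf hD

end Pushforward

section Principal

variable {W : Type*} [Fintype W] [DecidableEq W] (H : SimpleGraph W) [DecidableRel H.Adj]

/-- The principal divisor `∑_{u adjacent to v} ∂(→uv)`. -/
def vertexDivisor (v : W) : W → ℤ :=
  ∑ u ∈ H.neighborFinset v, (Pi.single v 1 - Pi.single u 1)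

lemma prin_eq_closure_range : Prin W H = AddSubgroup.closure (Set.range (vertexDivisor H)) := by
  unfold Prin
  congr 1
  ext D
  refine exists_congr fun v => ?_
  have h : vertexDivisor H v = fun w => ∑ u ∈ H.neighborFinset v,
      ((if w = v then (1 : ℤ) else 0) - (if w = u then (1 : ℤ) else 0)) := by
    ext w
    simp only [vertexDivisor, Finset.sum_apply, Pi.sub_apply, Pi.single_apply]
  rw [h, eq_comm]

lemma vertexDivisor_mem_prin (v : W) : vertexDivisor H v ∈ Prin W H := by
  rw [prin_eq_closure_range]
  exact AddSubgroup.subset_closure ⟨v, rfl⟩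

lemma sum_vertexDivisor : ∑ v, vertexDivisor H v = 0 := by
  simp only [vertexDivisor, SimpleGraph.neighborFinset_eq_filter, Finset.sum_filter]
  have h : ∀ v u : W, (if H.Adj v u then (Pi.single v 1 - Pi.single u 1 : W → ℤ) else 0)
      = (if H.Adj v u then Pi.single v 1 else 0) - (if H.Adj v u then Pi.single u 1 else 0) := by
    intro v u
    split_ifs <;> simp
  simp only [h, Finset.sum_sub_distrib]
  rw [Finset.sum_comm, sub_eq_zero]
  simp only [H.adj_comm]

lemma pushforward_vertexDivisor {Y : Type*} [Fintype Y] [DecidableEq Y] (f : W → Y) (v : W) :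
    pushforward f (vertexDivisor H v)
      = ∑ u ∈ H.neighborFinset v, (Pi.single (f v) 1 - Pi.single (f u) 1) := by
  simp only [vertexDivisor, map_sum, map_sub, pushforward_single]

lemma prin_le_comap_of_forall {A : Type*} [AddCommGroup A] {P : AddSubgroup A}
    {φ : (W → ℤ) →+ A} (h : ∀ v, φ (vertexDivisor H v) ∈ P) : Prin W H ≤ P.comap φ := by
  rw [prin_eq_closure_range, AddSubgroup.closure_le]
  rintro _ ⟨v, rfl⟩
  exact h v

/-- All but one of the vertex divisors already generate the principal divisors. -/
lemma prin_le_comap_of_forall_ne {A : Type*} [AddCommGroup A] {P : AddSubgroup A}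
    {φ : (W → ℤ) →+ A} (c : W) (h : ∀ v ≠ c, φ (vertexDivisor H v) ∈ P) :
    Prin W H ≤ P.comap φ := by
  refine prin_le_comap_of_forall H fun v => ?_
  by_cases hv : v = c
  · subst hv
    have hsum := Finset.add_sum_erase Finset.univ (vertexDivisor H) (Finset.mem_univ v)
    rw [sum_vertexDivisor] at hsum
    rw [eq_neg_of_add_eq_zero_left hsum, map_neg, map_sum]
    exact P.neg_mem (P.sum_mem fun u hu => h u (Finset.ne_of_mem_erase hu))
  · exact h v hv

end Principal

section Wedge

lemma pushforward_val_eq_extendZero [Fintype V] [DecidableEq V] (S : Set V)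
    [DecidablePred (· ∈ S)] (D : ↥S → ℤ) : pushforward Subtype.val D = extendZero S D := by
  ext w
  rw [pushforward_apply]
  by_cases hw : w ∈ S
  · rw [Finset.sum_eq_single ⟨w, hw⟩]
    · simp [extendZero, hw]
    · intro x _ hx
      exact if_neg fun h => hx (Subtype.ext h)
    · simp
  · simp only [extendZero, hw, dite_false]
    exact Finset.sum_eq_zero fun x _ => if_neg fun h : x.1 = w => hw (h ▸ x.2)

/-- The retraction of `V` onto `S` which sends all points outside `S` to `c`. -/
def retractTo {S : Set V} [DecidablePred (· ∈ S)] (c : ↥S) (v : V) : ↥S :=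
  if h : v ∈ S then ⟨v, h⟩ else c

lemma retractTo_of_mem {S : Set V} [DecidablePred (· ∈ S)] (c : ↥S) {v : V} (hv : v ∈ S) :
    retractTo c v = ⟨v, hv⟩ := dif_pos hv

lemma retractTo_of_notMem {S : Set V} [DecidablePred (· ∈ S)] (c : ↥S) {v : V} (hv : v ∉ S) :
    retractTo c v = c := dif_neg hv

lemma retractTo_comp_val {S : Set V} [DecidablePred (· ∈ S)] (c : ↥S) :
    retractTo c ∘ Subtype.val = id :=
  funext fun v => retractTo_of_mem c v.2

variable [Fintype V] [DecidableEq V] {G : SimpleGraph V} [DecidableRel G.Adj]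
  {S : Set V} [DecidablePred (· ∈ S)] {H : SimpleGraph ↥S} [DecidableRel H.Adj]

lemma prin_le_comap_val (c : ↥S) (hind : ∀ u v : ↥S, G.Adj u v ↔ H.Adj u v)
    (hatt : ∀ u v, u ∉ S → v ∈ S → G.Adj v u → v = c) :
    Prin ↥S H ≤ (Prin V G).comap (pushforward Subtype.val) := by
  refine prin_le_comap_of_forall_ne H c fun v hv => ?_
  have hnbr : G.neighborFinset v = (H.neighborFinset v).map (Function.Embedding.subtype _) := by
    ext u
    simp only [SimpleGraph.mem_neighborFinset, Finset.mem_map, Function.Embedding.coe_subtype]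
    constructor
    · intro h
      have hu : u ∈ S := by
        by_contra hu
        exact hv (Subtype.ext (hatt u v hu v.2 h))
      exact ⟨⟨u, hu⟩, (hind v ⟨u, hu⟩).1 h, rfl⟩
    · rintro ⟨u, hu, rfl⟩
      exact (hind v u).2 hu
  have h : pushforward Subtype.val (vertexDivisor H v) = vertexDivisor G v := by
    rw [pushforward_vertexDivisor, vertexDivisor, hnbr, Finset.sum_map]
    rfl
  rw [h]
  exact vertexDivisor_mem_prin G v

lemma prin_le_comap_retractTo (c : ↥S) (hind : ∀ u v : ↥S, G.Adj u v ↔ H.Adj u v)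
    (hatt : ∀ u v, u ∉ S → v ∈ S → G.Adj v u → v = c) :
    Prin V G ≤ (Prin ↥S H).comap (pushforward (retractTo c)) := by
  refine prin_le_comap_of_forall G fun v => ?_
  rw [pushforward_vertexDivisor]
  by_cases hv : v ∈ S
  · have h : ∑ u ∈ G.neighborFinset v, (Pi.single (retractTo c v) 1 - Pi.single (retractTo c u) 1)
        = vertexDivisor H ⟨v, hv⟩ := by
      have hsub : (H.neighborFinset ⟨v, hv⟩).map (Function.Embedding.subtype _)
          ⊆ G.neighborFinset v := by
        intro u hu
        obtain ⟨u, huv, rfl⟩ := Finset.mem_map.1 hu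
        exact (G.mem_neighborFinset _ _).2
          ((hind ⟨v, hv⟩ u).2 ((H.mem_neighborFinset _ _).1 huv))
      rw [← Finset.sum_subset hsub, Finset.sum_map, vertexDivisor]
      · refine Finset.sum_congr rfl fun u _ => ?_
        rw [retractTo_of_mem c hv, Function.Embedding.coe_subtype, retractTo_of_mem c u.2]
      · intro u hu hu'
        rw [SimpleGraph.mem_neighborFinset] at hu
        have huS : u ∉ S := fun huS => hu' <| Finset.mem_map.2
          ⟨⟨u, huS⟩, (H.mem_neighborFinset _ _).2 ((hind ⟨v, hv⟩ ⟨u, huS⟩).1 hu), rfl⟩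
        obtain rfl := hatt u v huS hv hu
        rw [retractTo_of_mem c hv, retractTo_of_notMem c huS, sub_self]
    rw [h]
    exact vertexDivisor_mem_prin H _
  · rw [Finset.sum_eq_zero]
    · exact zero_mem _
    · intro u hu
      rw [SimpleGraph.mem_neighborFinset] at hu
      have h : retractTo c u = c := by
        by_cases huS : u ∈ S
        · rw [retractTo_of_mem c huS]
          exact Subtype.ext (hatt v u hv huS hu.symm)
        · exact retractTo_of_notMem c huS
      rw [h, retractTo_of_notMem c hv, sub_self]

end Wedge

/-- **Lemma 4.** If `G = G₁ ∨_c G₂` is a wedge sum, then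
`Pic⁰(G₁) ⊕ Pic⁰(G₂) ≅ Pic⁰(G)`, via extending divisors by zero. -/
theorem pic_wedge_iso [Fintype V] [DecidableEq V]
    (G : SimpleGraph V) [DecidableRel G.Adj] (hG : G.Connected)
    (c : V) (V₁ V₂ : Set V) [DecidablePred (· ∈ V₁)] [DecidablePred (· ∈ V₂)]
    (G₁ : SimpleGraph ↥V₁) [DecidableRel G₁.Adj]
    (G₂ : SimpleGraph ↥V₂) [DecidableRel G₂.Adj]
    (hVcap : V₁ ∩ V₂ = {c}) (hVcup : V₁ ∪ V₂ = Set.univ)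
    (hAdj : ∀ u v : V, G.Adj u v ↔
      ((∃ (hu : u ∈ V₁) (hv : v ∈ V₁), G₁.Adj ⟨u, hu⟩ ⟨v, hv⟩) ∨
       (∃ (hu : u ∈ V₂) (hv : v ∈ V₂), G₂.Adj ⟨u, hu⟩ ⟨v, hv⟩)))
    (hDisj : ∀ u v : V,
      ¬((∃ (hu : u ∈ V₁) (hv : v ∈ V₁), G₁.Adj ⟨u, hu⟩ ⟨v, hv⟩) ∧
        (∃ (hu : u ∈ V₂) (hv : v ∈ V₂), G₂.Adj ⟨u, hu⟩ ⟨v, hv⟩))) :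
    ∃ φ : (Pic ↥V₁ G₁ × Pic ↥V₂ G₂) ≃+ Pic V G,
      ∀ (D₁ : ↥(Div0 ↥V₁)) (D₂ : ↥(Div0 ↥V₂)),
        φ (QuotientAddGroup.mk D₁, QuotientAddGroup.mk D₂) =
          QuotientAddGroup.mk
            ⟨extendZero V₁ (D₁ : ↥V₁ → ℤ) + extendZero V₂ (D₂ : ↥V₂ → ℤ),
              extendZero_add_mem V₁ V₂ D₁ D₂⟩ := by
  have hc : c ∈ V₁ ∩ V₂ := by rw [hVcap]; rfl
  have heq : ∀ v, v ∈ V₁ → v ∈ V₂ → v = c := fun v h1 h2 => by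
    have : v ∈ V₁ ∩ V₂ := ⟨h1, h2⟩
    rwa [hVcap] at this
  have hcup : ∀ v, v ∈ V₁ ∨ v ∈ V₂ := fun v => by
    have : v ∈ V₁ ∪ V₂ := by rw [hVcup]; trivial
    exact this
  have hind₁ : ∀ u v : ↥V₁, G.Adj u v ↔ G₁.Adj u v := fun u v => by
    refine ⟨fun h => ?_, fun h => (hAdj u v).2 (Or.inl ⟨u.2, v.2, h⟩)⟩
    rcases (hAdj u v).1 h with ⟨_, _, h'⟩ | ⟨hu, hv, _⟩
    · exact h'
    · exact absurd ((heq u u.2 hu).trans (heq v v.2 hv).symm) h.ne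
  have hind₂ : ∀ u v : ↥V₂, G.Adj u v ↔ G₂.Adj u v := fun u v => by
    refine ⟨fun h => ?_, fun h => (hAdj u v).2 (Or.inr ⟨u.2, v.2, h⟩)⟩
    rcases (hAdj u v).1 h with ⟨hu, hv, _⟩ | ⟨_, _, h'⟩
    · exact absurd ((heq u hu u.2).trans (heq v hv v.2).symm) h.ne
    · exact h'
  have hatt₁ : ∀ u v, u ∉ V₁ → v ∈ V₁ → G.Adj v u → v = c := fun u v hu hv h => by
    rcases (hAdj v u).1 h with ⟨_, hu', _⟩ | ⟨hv', _, _⟩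
    · exact absurd hu' hu
    · exact heq v hv hv'
  have hatt₂ : ∀ u v, u ∉ V₂ → v ∈ V₂ → G.Adj v u → v = c := fun u v hu hv h => by
    rcases (hAdj v u).1 h with ⟨hv', _, _⟩ | ⟨_, hu', _⟩
    · exact heq v hv' hv
    · exact absurd hu' hu
  let c₁ : ↥V₁ := ⟨c, hc.1⟩
  let c₂ : ↥V₂ := ⟨c, hc.2⟩
  have h₁₂ : retractTo c₁ ∘ (Subtype.val : ↥V₂ → V) = fun _ => c₁ := funext fun v => by
    by_cases hv : v.1 ∈ V₁
    · exact (retractTo_of_mem c₁ hv).trans (Subtype.ext (heq v hv v.2))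
    · exact retractTo_of_notMem c₁ hv
  have h₂₁ : retractTo c₂ ∘ (Subtype.val : ↥V₁ → V) = fun _ => c₂ := funext fun v => by
    by_cases hv : v.1 ∈ V₂
    · exact (retractTo_of_mem c₂ hv).trans (Subtype.ext (heq v v.2 hv))
    · exact retractTo_of_notMem c₂ hv
  have hsplit : ∀ v : V,
      ((Subtype.val ∘ retractTo c₁) v = v ∧ (Subtype.val ∘ retractTo c₂) v = c) ∨
      ((Subtype.val ∘ retractTo c₁) v = c ∧ (Subtype.val ∘ retractTo c₂) v = v) := fun v => by
    by_cases h1 : v ∈ V₁ <;> by_cases h2 : v ∈ V₂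
    · simp [retractTo, heq v h1 h2, hc.1, hc.2]
    · simp [retractTo, h1, h2, c₂]
    · simp [retractTo, h1, h2, c₁]
    · exact absurd (hcup v) (by simp [h1, h2])
  let ψ : (Pic ↥V₁ G₁ × Pic ↥V₂ G₂) →+ Pic V G :=
    (picMap Subtype.val (prin_le_comap_val c₁ hind₁ hatt₁)).coprod
      (picMap Subtype.val (prin_le_comap_val c₂ hind₂ hatt₂))
  let χ : Pic V G →+ (Pic ↥V₁ G₁ × Pic ↥V₂ G₂) :=
    (picMap (retractTo c₁) (prin_le_comap_retractTo c₁ hind₁ hatt₁)).prod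
      (picMap (retractTo c₂) (prin_le_comap_retractTo c₂ hind₂ hatt₂))
  have hψ : ∀ (D₁ : ↥(Div0 ↥V₁)) (D₂ : ↥(Div0 ↥V₂)),
      ψ (QuotientAddGroup.mk D₁, QuotientAddGroup.mk D₂)
        = QuotientAddGroup.mk (div0Map Subtype.val D₁ + div0Map Subtype.val D₂) :=
    fun _ _ => rfl
  have hχ : ∀ D : ↥(Div0 V), χ (QuotientAddGroup.mk D)
      = (QuotientAddGroup.mk (div0Map (retractTo c₁) D),
          QuotientAddGroup.mk (div0Map (retractTo c₂) D)) := fun _ => rfl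
  have hχψ : χ.comp ψ = AddMonoidHom.id _ := by
    refine AddMonoidHom.ext fun ⟨x, y⟩ => ?_
    obtain ⟨D₁, rfl⟩ := QuotientAddGroup.mk_surjective x
    obtain ⟨D₂, rfl⟩ := QuotientAddGroup.mk_surjective y
    rw [AddMonoidHom.comp_apply, hψ, hχ, AddMonoidHom.id_apply]
    congr 2 <;> refine Subtype.ext ?_ <;>
      simp only [map_add, AddSubgroup.coe_add, coe_div0Map, pushforward_pushforward]
    · rw [retractTo_comp_val, h₁₂, pushforward_id, pushforward_const D₂.2, add_zero]
    · rw [retractTo_comp_val, h₂₁, pushforward_id, pushforward_const D₁.2, zero_add]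
  have hψχ : ψ.comp χ = AddMonoidHom.id _ := by
    refine AddMonoidHom.ext fun x => ?_
    obtain ⟨D, rfl⟩ := QuotientAddGroup.mk_surjective x
    rw [AddMonoidHom.comp_apply, hχ, hψ, AddMonoidHom.id_apply]
    congr 1
    refine Subtype.ext ?_
    simp only [AddSubgroup.coe_add, coe_div0Map, pushforward_pushforward]
    exact pushforward_add_pushforward hsplit D.2
  refine ⟨ψ.toAddEquiv χ hχψ hψχ, fun D₁ D₂ => (hψ D₁ D₂).trans ?_⟩
  congr 1
  refine Subtype.ext ?_
  simp only [AddSubgroup.coe_add, coe_div0Map, pushforward_val_eq_extendZero]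
end

section
/- Let G₁ be a finite connected simple graph, let c be a vertex of G₁, and suppose the set of neighbors of c in G₁ is partitioned into two disjoint sets X = {x₁, …, x_N} and Y. Suppose G₁ contains a cycle with vertex sequence c, f₁, f₂, …, f_k, c (the vertices c, f₁, …, f_k distinct, consecutive ones adjacent, k ≥ 2) such that f_k ∈ X and f₁ ∈ Y. Then the divisor 2·∑_{i=1}^{N} ((x_i) − (c)) is not principal on G₁, i.e., 2∑_{i=1}^{N} ∂(→c x_i) ≁ 0 in G₁. -/
open Finset

variable {V : Type*}

/-- Discrete Green identity: twice the pairing of `f` with its Laplacian is the sum of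
`(f w - f u) ^ 2` over all darts. -/
theorem two_mul_sum_mul_laplacian [Fintype V] (G : SimpleGraph V) [DecidableRel G.Adj]
    (f : V → ℤ) :
    2 * ∑ w, f w * ∑ u ∈ G.neighborFinset w, (f w - f u) =
      ∑ w, ∑ u, if G.Adj w u then (f w - f u) ^ 2 else 0 := by
  have hsum : ∑ w, f w * ∑ u ∈ G.neighborFinset w, (f w - f u) =
      ∑ w, ∑ u, if G.Adj w u then f w * (f w - f u) else 0 := by
    refine sum_congr rfl fun w _ => ?_
    rw [mul_sum, SimpleGraph.neighborFinset_eq_filter, sum_filter]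
  have hswap : ∑ w, f w * ∑ u ∈ G.neighborFinset w, (f w - f u) =
      ∑ w, ∑ u, if G.Adj w u then f u * (f u - f w) else 0 := by
    rw [hsum, sum_comm]
    simp only [G.adj_comm]
  rw [two_mul]
  nth_rewrite 1 [hsum]
  rw [hswap, ← sum_add_distrib]
  refine sum_congr rfl fun w _ => ?_
  rw [← sum_add_distrib]
  refine sum_congr rfl fun u _ => ?_
  split_ifs <;> ring

/-- The dart energy of a function vanishing at `c` splits into the contribution of the edges at `c`
and that of the edges avoiding `c`. -/
theorem sum_dart_sq_eq_add_of_eq_zero [Fintype V] [DecidableEq V] (G : SimpleGraph V)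
    [DecidableRel G.Adj] (f : V → ℤ) {c : V} (hc : f c = 0) :
    (∑ w, ∑ u, if G.Adj w u then (f w - f u) ^ 2 else 0) =
      2 * ∑ u ∈ G.neighborFinset c, f u ^ 2 +
        ∑ w ∈ univ.erase c, ∑ u ∈ univ.erase c,
          if G.Adj w u then (f w - f u) ^ 2 else 0 := by
  have hstar : ∑ u ∈ univ.erase c, (if G.Adj c u then (f c - f u) ^ 2 else 0) =
      ∑ u ∈ G.neighborFinset c, f u ^ 2 := by
    rw [SimpleGraph.neighborFinset_eq_filter, sum_filter, ← add_sum_erase univ _ (mem_univ c)]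
    simp [hc]
  have hstar' : ∑ w ∈ univ.erase c, (if G.Adj w c then (f w - f c) ^ 2 else 0) =
      ∑ u ∈ G.neighborFinset c, f u ^ 2 := by
    rw [← hstar]
    refine sum_congr rfl fun w _ => ?_
    simp only [G.adj_comm w c, sub_sq_comm (f w)]
  have hrow (w : V) : (∑ u, if G.Adj w u then (f w - f u) ^ 2 else 0) =
      (if G.Adj w c then (f w - f c) ^ 2 else 0) +
        ∑ u ∈ univ.erase c, if G.Adj w u then (f w - f u) ^ 2 else 0 :=
    (add_sum_erase univ _ (mem_univ c)).symm
  rw [← add_sum_erase univ _ (mem_univ c)]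
  simp only [hrow, sum_add_distrib]
  rw [hstar, hstar']
  simp only [SimpleGraph.irrefl, if_false]
  ring

/-- If the neighborhood of `c` is the disjoint union of `X` and `Y`, and `f` vanishes at `c` and
has Laplacian `2 ∑ x ∈ X, ((x) - (c))`, then `f` is constant along every edge avoiding `c`. -/
theorem eq_of_adj_of_laplacian_eq [Fintype V] [DecidableEq V] (G : SimpleGraph V)
    [DecidableRel G.Adj] {c : V} {X Y : Finset V} (hXY : Disjoint X Y)
    (hcover : X ∪ Y = G.neighborFinset c) {f : V → ℤ} (hc : f c = 0)
    (hf : ∀ w, 2 * ∑ x ∈ X, ((if w = x then (1 : ℤ) else 0) - (if w = c then (1 : ℤ) else 0)) =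
      ∑ u ∈ G.neighborFinset w, (f w - f u))
    {v w : V} (hv : v ≠ c) (hw : w ≠ c) (hvw : G.Adj v w) : f v = f w := by
  have hcX : c ∉ X := fun h => by
    have : c ∈ G.neighborFinset c := hcover ▸ mem_union_left Y h
    simp at this
  have hpair : ∑ w, f w * ∑ u ∈ G.neighborFinset w, (f w - f u) = 2 * ∑ x ∈ X, f x := by
    simp only [← hf, sum_sub_distrib, sum_ite_eq, sum_const]
    rw [← sum_filter_add_sum_filter_not univ (· ∈ X)]
    have h1 : ∑ w with w ∈ X, f w * (2 * ((if w ∈ X then (1 : ℤ) else 0) -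
        #X • (if w = c then (1 : ℤ) else 0))) = 2 * ∑ x ∈ X, f x := by
      rw [filter_univ_mem, mul_sum]
      refine sum_congr rfl fun x hx => ?_
      rw [if_pos hx, if_neg (ne_of_mem_of_not_mem hx hcX)]
      simp [mul_comm]
    have h2 : ∑ w with w ∉ X, f w * (2 * ((if w ∈ X then (1 : ℤ) else 0) -
        #X • (if w = c then (1 : ℤ) else 0))) = 0 := by
      refine sum_eq_zero fun x hx => ?_
      rw [if_neg (mem_filter.1 hx).2]
      split_ifs with h
      · simp [h, hc]
      · simp
    rw [h1, h2, add_zero]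
  have hflux : ∑ x ∈ X, f x + ∑ y ∈ Y, f y = 2 * #X := by
    have h := hf c
    rw [← hcover, sum_union hXY] at h
    simp only [sum_sub_distrib, sum_ite_eq, hcX, hc, if_true, if_false, sum_const] at h
    simp at h
    linarith
  have henergy := two_mul_sum_mul_laplacian G f
  rw [hpair, sum_dart_sq_eq_add_of_eq_zero G f hc, ← hcover, sum_union hXY] at henergy
  have hX : 0 ≤ ∑ x ∈ X, f x ^ 2 - 3 * ∑ x ∈ X, f x + 2 * #X := by
    have h : 0 ≤ ∑ x ∈ X, (f x ^ 2 - 3 * f x + 2) := sum_nonneg fun x _ => by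
      rcases le_or_gt (f x) 1 with h | h <;> nlinarith
    rw [sum_add_distrib, sum_sub_distrib, ← mul_sum, sum_const, nsmul_eq_mul] at h
    linarith
  have hY : 0 ≤ ∑ y ∈ Y, f y ^ 2 - ∑ y ∈ Y, f y := by
    rw [← sum_sub_distrib]
    refine sum_nonneg fun y _ => ?_
    rcases le_or_gt (f y) 0 with h | h <;> nlinarith
  have hterm (a b : V) : 0 ≤ if G.Adj a b then (f a - f b) ^ 2 else 0 := by
    split_ifs <;> positivity
  have hle : (if G.Adj v w then (f v - f w) ^ 2 else 0) ≤
      ∑ a ∈ univ.erase c, ∑ b ∈ univ.erase c, if G.Adj a b then (f a - f b) ^ 2 else 0 :=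
    (single_le_sum (f := fun b => if G.Adj v b then (f v - f b) ^ 2 else 0)
      (fun b _ => hterm v b) (mem_erase.2 ⟨hw, mem_univ w⟩)).trans
    (single_le_sum (f := fun a => ∑ b ∈ univ.erase c, if G.Adj a b then (f a - f b) ^ 2 else 0)
      (fun a _ => sum_nonneg fun b _ => hterm a b) (mem_erase.2 ⟨hv, mem_univ v⟩))
  rw [if_pos hvw] at hle
  have hzero : (f v - f w) ^ 2 = 0 := le_antisymm (by linarith) (sq_nonneg _)
  exact sub_eq_zero.1 (pow_eq_zero_iff two_ne_zero |>.1 hzero)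

/-- **Lemma 5.** Suppose the neighborhood of `c` in `G₁` is partitioned into `X` and `Y`,
and `G₁` contains a cycle `c, f₁, …, f_k, c` with `f_k ∈ X` and `f₁ ∈ Y`.
Then `2 ∑_{x ∈ X} ((x) − (c))` is not principal on `G₁`. -/
theorem two_mul_cut_sum_not_principal [Fintype V] [DecidableEq V]
    (G₁ : SimpleGraph V) [DecidableRel G₁.Adj] (hG₁ : G₁.Connected)
    (c : V) (X Y : Finset V)
    (hXY : Disjoint X Y) (hcover : X ∪ Y = G₁.neighborFinset c)
    (k : ℕ) (hk : 2 ≤ k) (f : Fin k → V)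
    (hinj : Function.Injective f) (hfc : ∀ i, f i ≠ c)
    (hfirst : G₁.Adj c (f ⟨0, by omega⟩))
    (hchain : ∀ i : ℕ, (hi : i + 1 < k) → G₁.Adj (f ⟨i, by omega⟩) (f ⟨i + 1, hi⟩))
    (hlast : G₁.Adj (f ⟨k - 1, by omega⟩) c)
    (hfk : f ⟨k - 1, by omega⟩ ∈ X) (hf1 : f ⟨0, by omega⟩ ∈ Y) :
    ¬ IsPrincipal G₁ (fun w =>
      2 * ∑ x ∈ X, ((if w = x then (1 : ℤ) else 0) - (if w = c then (1 : ℤ) else 0))) := by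
  rintro ⟨g, hg⟩
  set h : V → ℤ := fun w => g w - g c with hh
  have hc : h c = 0 := sub_self _
  have hlap (w : V) :
      2 * ∑ x ∈ X, ((if w = x then (1 : ℤ) else 0) - (if w = c then (1 : ℤ) else 0)) =
        ∑ u ∈ G₁.neighborFinset w, (h w - h u) := by
    simpa only [hh, sub_sub_sub_cancel_right] using hg w
  have hedge {v w : V} (hv : v ≠ c) (hw : w ≠ c) (hvw : G₁.Adj v w) : h v = h w :=
    eq_of_adj_of_laplacian_eq G₁ hXY hcover hc hlap hv hw hvw
  have hval {v : V} (hv : v ≠ c) (hcv : G₁.Adj v c) : h v = if v ∈ X then 2 else 0 := by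
    have hsum : ∑ u ∈ G₁.neighborFinset v, (h v - h u) = h v := by
      rw [sum_eq_single c, hc, sub_zero]
      · intro u hu huc
        rw [hedge hv huc ((G₁.mem_neighborFinset v u).1 hu), sub_self]
      · exact fun hn => absurd ((G₁.mem_neighborFinset v c).2 hcv) hn
    rw [← hsum, ← hlap v]
    simp [hv]
  have hpath (i : ℕ) (hi : i < k) : h (f ⟨i, hi⟩) = h (f ⟨0, by omega⟩) := by
    induction i with
    | zero => rfl
    | succ i ih => rw [← ih (by omega), hedge (hfc _) (hfc _) (hchain i hi)]
  have hend := hpath (k - 1) (by omega)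
  rw [hval (hfc _) hlast, hval (hfc _) hfirst.symm, if_pos hfk,
    if_neg (disjoint_right.1 hXY hf1)] at hend
  norm_num at hend
end

section
/- If a non-planar finite connected simple ribbon graph G contains a type I configuration, then G is of type A: G contains a type I configuration, with vertices c, b, a₁,…,a_n, d₁,…,d_m, f₁,…,f_k, such that no vertex of the configuration other than c lies in the same connected component as some x_i in the graph obtained from G by deleting the vertex c, where x₁,…,x_N are the heads of the darts with tail c lying strictly between c→a₁ and c→d₁ in the cyclic order at c (i.e., the darts σ(c→a₁), σ²(c→a₁), …, up to but not including c→d₁). -/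
open Finset

variable {V : Type*}

/-- A ribbon structure on a simple graph `G`: a permutation of the darts preserving
tails, whose darts at each vertex form a single cycle. -/
structure RibbonStructure [Fintype V] [DecidableEq V] (G : SimpleGraph V)
    [DecidableRel G.Adj] where
  σ : Equiv.Perm G.Dart
  tail_eq : ∀ d : G.Dart, (σ d).toProd.1 = d.toProd.1
  single_cycle : ∀ d e : G.Dart, d.toProd.1 = e.toProd.1 → ∃ n : ℕ, (σ ^ n) d = e

namespace RibbonStructure

variable [Fintype V] [DecidableEq V] {G : SimpleGraph V} [DecidableRel G.Adj]

/-- The dart-reversal of a simple graph, as a permutation of darts. -/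
def dartReverse (G : SimpleGraph V) [DecidableRel G.Adj] : Equiv.Perm G.Dart :=
  ⟨SimpleGraph.Dart.symm, SimpleGraph.Dart.symm,
    fun d => SimpleGraph.Dart.symm_symm d, fun d => SimpleGraph.Dart.symm_symm d⟩

/-- The face permutation of a ribbon graph sends a dart `d` to `σ(d̄)`. -/
def facePerm (R : RibbonStructure G) : Equiv.Perm G.Dart :=
  (dartReverse G).trans R.σ

/-- The setoid whose classes are the cycles (orbits) of a permutation. -/
def sameCycleSetoid {α : Type*} (π : Equiv.Perm α) : Setoid α :=
  ⟨π.SameCycle, ⟨fun _ => Equiv.Perm.SameCycle.refl _ _, Equiv.Perm.SameCycle.symm,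
    Equiv.Perm.SameCycle.trans⟩⟩

/-- The number of faces of a ribbon graph: the number of orbits of the face permutation. -/
noncomputable def numFaces (R : RibbonStructure G) : ℕ :=
  Nat.card (Quotient (sameCycleSetoid R.facePerm))

/-- A connected ribbon graph is planar if `|V| − |E| + F = 2`. -/
def IsPlanar (R : RibbonStructure G) : Prop :=
  (Fintype.card V : ℤ) - (G.edgeFinset.card : ℤ) + (R.numFaces : ℤ) = 2

end RibbonStructure

/-- Listing the `σ`-orbit of `d₁` starting from `d₁`, the element `d₂` appears
(strictly) before `d₃`: i.e. the three elements occur in cyclic order `(d₁, d₂, d₃)`. -/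
def CyclicOrder3 {α : Type*} (σ : Equiv.Perm α) (d₁ d₂ d₃ : α) : Prop :=
  ∃ i j : ℕ, 0 < i ∧ i < j ∧ (σ ^ i) d₁ = d₂ ∧ (σ ^ j) d₁ = d₃ ∧
    ∀ l : ℕ, 0 < l → l < j → (σ ^ l) d₁ ≠ d₁

/-- The four elements occur in cyclic order `(d₁, d₂, d₃, d₄)` for `σ`. -/
def CyclicOrder4 {α : Type*} (σ : Equiv.Perm α) (d₁ d₂ d₃ d₄ : α) : Prop :=
  ∃ i j l : ℕ, 0 < i ∧ i < j ∧ j < l ∧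
    (σ ^ i) d₁ = d₂ ∧ (σ ^ j) d₁ = d₃ ∧ (σ ^ l) d₁ = d₄ ∧
    ∀ t : ℕ, 0 < t → t < l → (σ ^ t) d₁ ≠ d₁

/-- The vertex list `c, s₁, …, s_n, b` of a path from `c` to `b` with internal
vertices `s₁, …, s_n`. -/
def pathList {n : ℕ} (c b : V) (s : Fin n → V) : List V :=
  c :: (List.ofFn s ++ [b])

/-- `c, s₁, …, s_n, b` is a path in `G` from `c` to `b`:
consecutive vertices are adjacent and all vertices are distinct. -/
def IsPathSeq (G : SimpleGraph V) {n : ℕ} (c b : V) (s : Fin n → V) : Prop :=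
  (pathList c b s).Chain' G.Adj ∧ (pathList c b s).Nodup

/-- The first internal vertex of a path from `c` to `b`
(which is `b` itself when there are no internal vertices). -/
def headV {n : ℕ} (s : Fin n → V) (b : V) : V :=
  if h : 0 < n then s ⟨0, h⟩ else b

/-- The last internal vertex of a path from `c` to `b`
(which is `c` itself when there are no internal vertices). -/
def lastV {n : ℕ} (s : Fin n → V) (c : V) : V :=
  if h : 0 < n then s ⟨n - 1, by omega⟩ else c

/-- A type I configuration in a ribbon graph: two distinct vertices `c`, `b` and three
paths from `c` to `b` pairwise sharing only `c` and `b`, whose initial darts at `c`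
occur in cyclic order `(c→a₁, c→d₁, c→f₁)` and whose initial darts at `b` occur in
cyclic order `(b→f_k, b→a_n, b→d_m)`. -/
structure TypeIConfig [Fintype V] [DecidableEq V] (G : SimpleGraph V)
    [DecidableRel G.Adj] (R : RibbonStructure G) where
  c : V
  b : V
  n : ℕ
  m : ℕ
  k : ℕ
  a : Fin n → V
  d : Fin m → V
  f : Fin k → V
  path_a : IsPathSeq G c b a
  path_d : IsPathSeq G c b d
  path_f : IsPathSeq G c b f
  disj_ad : ∀ i j, a i ≠ d j
  disj_af : ∀ i j, a i ≠ f j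
  disj_df : ∀ i j, d i ≠ f j
  cyc_c : ∃ e₁ e₂ e₃ : G.Dart, e₁.toProd = (c, headV a b) ∧ e₂.toProd = (c, headV d b) ∧
    e₃.toProd = (c, headV f b) ∧ CyclicOrder3 R.σ e₁ e₂ e₃
  cyc_b : ∃ e₁ e₂ e₃ : G.Dart, e₁.toProd = (b, lastV f c) ∧ e₂.toProd = (b, lastV a c) ∧
    e₃.toProd = (b, lastV d c) ∧ CyclicOrder3 R.σ e₁ e₂ e₃

/-- The vertex list `c, s₁, …, s_n` (with `s_n` adjacent to `c`) is a cycle of `G`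
through `c`: consecutive vertices are adjacent, the last vertex is adjacent to `c`,
and all vertices are distinct. -/
def IsCycleSeq (G : SimpleGraph V) {n : ℕ} (c : V) (s : Fin n → V) (hn : 2 ≤ n) : Prop :=
  (c :: List.ofFn s).Chain' G.Adj ∧ (c :: List.ofFn s).Nodup ∧
    G.Adj (s ⟨n - 1, by omega⟩) c

/-- A type II configuration in a ribbon graph: a vertex `c` and two cycles through `c`
sharing only the vertex `c`, whose darts at `c` occur in cyclic order
`(c→a₁, c→f_k, c→a_n, c→f₁)`. -/
structure TypeIIConfig [Fintype V] [DecidableEq V] (G : SimpleGraph V)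
    [DecidableRel G.Adj] (R : RibbonStructure G) where
  c : V
  n : ℕ
  k : ℕ
  hn : 2 ≤ n
  hk : 2 ≤ k
  a : Fin n → V
  f : Fin k → V
  cycle_a : IsCycleSeq G c a hn
  cycle_f : IsCycleSeq G c f hk
  disj_af : ∀ i j, a i ≠ f j
  cyc_c : ∃ e₁ e₂ e₃ e₄ : G.Dart,
    e₁.toProd = (c, a ⟨0, by omega⟩) ∧ e₂.toProd = (c, f ⟨k - 1, by omega⟩) ∧
    e₃.toProd = (c, a ⟨n - 1, by omega⟩) ∧ e₄.toProd = (c, f ⟨0, by omega⟩) ∧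
    CyclicOrder4 R.σ e₁ e₂ e₃ e₄

/-- The heads of the darts with tail `c` lying strictly between the dart `c → v₁`
and the dart `c → v₂` in the cyclic order at `c`. -/
def betweenHeads [Fintype V] [DecidableEq V] (G : SimpleGraph V) [DecidableRel G.Adj]
    (R : RibbonStructure G) (c v₁ v₂ : V) : Set V :=
  {x | ∃ e₁ e₂ e : G.Dart, e₁.toProd = (c, v₁) ∧ e₂.toProd = (c, v₂) ∧
    CyclicOrder3 R.σ e₁ e e₂ ∧ e.toProd.2 = x}

/-- `G` is of type A, witnessed by the type I configuration `K`: no vertex of `K`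
other than `c` lies in the same connected component as some `x_i` in the graph
obtained from `G` by deleting `c`, where the `x_i` are the heads of the darts with
tail `c` lying strictly between `c→a₁` and `c→d₁` in the cyclic order at `c`. -/
def IsTypeAWitness [Fintype V] [DecidableEq V] {G : SimpleGraph V} [DecidableRel G.Adj]
    {R : RibbonStructure G} (K : TypeIConfig G R) : Prop :=
  ∀ u : V, (u = K.b ∨ (∃ i, K.a i = u) ∨ (∃ i, K.d i = u) ∨ (∃ i, K.f i = u)) →
    ∀ (hu : u ≠ K.c) (x : V) (hx : x ≠ K.c),
      x ∈ betweenHeads G R K.c (headV K.a K.b) (headV K.d K.b) →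
      ¬ (G.induce {v : V | v ≠ K.c}).Reachable ⟨u, hu⟩ ⟨x, hx⟩

/-- `G` is of type B, witnessed by the type II configuration `K`: none of the
vertices `a₁, …, a_n` lies in the same connected component as some `x_i` in the graph
obtained from `G` by deleting `c`, where the `x_i` are the heads of the darts with
tail `c` lying strictly between `c→a₁` and `c→a_n` in the cyclic order at `c`. -/
def IsTypeBWitness [Fintype V] [DecidableEq V] {G : SimpleGraph V} [DecidableRel G.Adj]
    {R : RibbonStructure G} (K : TypeIIConfig G R) : Prop :=
  ∀ (i : Fin K.n) (hu : K.a i ≠ K.c) (x : V) (hx : x ≠ K.c),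
    x ∈ betweenHeads G R K.c (K.a ⟨0, by have := K.hn; omega⟩)
      (K.a ⟨K.n - 1, by have := K.hn; omega⟩) →
    ¬ (G.induce {v : V | v ≠ K.c}).Reachable ⟨K.a i, hu⟩ ⟨x, hx⟩

section CyclicOrder

variable {α : Type*} {σ : Equiv.Perm α} {x y z w : α}

theorem CyclicOrder3.exists_lt_minimalPeriod [Finite α] (h : CyclicOrder3 σ x y z) (hxz : x ≠ z) :
    ∃ i j : ℕ, 0 < i ∧ i < j ∧ j < Function.minimalPeriod σ x ∧
      (σ ^ i) x = y ∧ (σ ^ j) x = z := by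
  obtain ⟨i, j, hi, hij, hy, hz, hmin⟩ := h
  refine ⟨i, j, hi, hij, ?_, hy, hz⟩
  by_contra! hle
  have hpos : 0 < Function.minimalPeriod σ x :=
    Function.minimalPeriod_pos_of_mem_periodicPts
      (σ.injective.mem_periodicPts x)
  have hper : (σ ^ Function.minimalPeriod σ x) x = x := by
    rw [← Equiv.Perm.iterate_eq_pow]
    exact Function.iterate_minimalPeriod
  rcases hle.lt_or_eq with hlt | heq
  · exact hmin _ hpos hlt hper
  · exact hxz (by rw [← hz, ← heq, hper])

theorem cyclicOrder3_of_lt_minimalPeriod {i j : ℕ} (hi : 0 < i) (hij : i < j)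
    (hj : j < Function.minimalPeriod σ x) :
    CyclicOrder3 σ x ((σ ^ i) x) ((σ ^ j) x) := by
  refine ⟨i, j, hi, hij, rfl, rfl, fun l hl hlj h => ?_⟩
  rw [← Equiv.Perm.iterate_eq_pow] at h
  exact Function.not_isPeriodicPt_of_pos_of_lt_minimalPeriod hl.ne' (hlj.trans hj) h

theorem CyclicOrder3.left_ne (h : CyclicOrder3 σ x y z) : x ≠ y := by
  obtain ⟨i, j, hi, hij, rfl, -, hmin⟩ := h
  exact (hmin i hi hij).symm

theorem CyclicOrder3.right_ne (h : CyclicOrder3 σ x y z) : y ≠ z := by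
  obtain ⟨i, j, hi, hij, rfl, rfl, hmin⟩ := h
  intro he
  refine hmin (j - i) (by omega) (by omega) ((σ ^ i).injective ?_)
  rw [← Equiv.Perm.mul_apply, ← pow_add, he]
  congr 2
  omega

theorem CyclicOrder3.rotate [Finite α] (h : CyclicOrder3 σ x y z) (hxz : x ≠ z) :
    CyclicOrder3 σ y z x := by
  obtain ⟨i, j, hi, hij, hj, rfl, rfl⟩ := h.exists_lt_minimalPeriod hxz
  have hper : (σ ^ Function.minimalPeriod σ x) x = x := by
    rw [← Equiv.Perm.iterate_eq_pow]
    exact Function.iterate_minimalPeriod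
  refine ⟨j - i, Function.minimalPeriod σ x - i, by omega, by omega, ?_, ?_,
    fun l hl hlt he => ?_⟩
  · rw [← Equiv.Perm.mul_apply, ← pow_add]
    congr 2
    omega
  · rw [← Equiv.Perm.mul_apply, ← pow_add, Nat.sub_add_cancel (by omega), hper]
  · rw [← Equiv.Perm.mul_apply, ← pow_add, add_comm, pow_add, Equiv.Perm.mul_apply] at he
    have he := (σ ^ i).injective he
    rw [← Equiv.Perm.iterate_eq_pow] at he
    exact Function.not_isPeriodicPt_of_pos_of_lt_minimalPeriod hl.ne' (by omega) he

theorem CyclicOrder3.trans [Finite α] (h : CyclicOrder3 σ x y z) (hxz : x ≠ z)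
    (h' : CyclicOrder3 σ x z w) (hxw : x ≠ w) : CyclicOrder3 σ x y w := by
  obtain ⟨i, j, hi, hij, hj, rfl, rfl⟩ := h.exists_lt_minimalPeriod hxz
  obtain ⟨j', k, hj', hjk, hk, he, rfl⟩ := h'.exists_lt_minimalPeriod hxw
  simp only [← Equiv.Perm.iterate_eq_pow] at he
  have : j' = j := Function.iterate_injOn_Iio_minimalPeriod (f := σ) (x := x)
    (by simp only [Set.mem_Iio]; omega) (by simpa using hj) he
  exact cyclicOrder3_of_lt_minimalPeriod hi (by omega) hk

theorem exists_pow_lt_minimalPeriod [Finite α] {n : ℕ} (h : (σ ^ n) x = y) (hxy : x ≠ y) :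
    ∃ i, 0 < i ∧ i < Function.minimalPeriod σ x ∧ (σ ^ i) x = y := by
  have hpos : 0 < Function.minimalPeriod σ x :=
    Function.minimalPeriod_pos_of_mem_periodicPts
      (σ.injective.mem_periodicPts x)
  have hy : (σ ^ (n % Function.minimalPeriod σ x)) x = y := by
    rw [← h, ← Equiv.Perm.iterate_eq_pow, ← Equiv.Perm.iterate_eq_pow]
    exact Function.iterate_mod_minimalPeriod_eq
  refine ⟨_, Nat.pos_of_ne_zero fun h0 => hxy ?_, Nat.mod_lt _ hpos, hy⟩
  rw [← hy, h0]
  simp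

theorem cyclicOrder3_total [Finite α] (hy : ∃ n : ℕ, (σ ^ n) x = y)
    (hz : ∃ n : ℕ, (σ ^ n) x = z) (hxy : x ≠ y) (hxz : x ≠ z) (hyz : y ≠ z) :
    CyclicOrder3 σ x y z ∨ CyclicOrder3 σ x z y := by
  obtain ⟨n, hn⟩ := hy
  obtain ⟨k, hk⟩ := hz
  obtain ⟨i, hi, hi', rfl⟩ := exists_pow_lt_minimalPeriod hn hxy
  obtain ⟨j, hj, hj', rfl⟩ := exists_pow_lt_minimalPeriod hk hxz
  rcases lt_trichotomy i j with h | rfl | h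
  · exact Or.inl (cyclicOrder3_of_lt_minimalPeriod hi h hj')
  · exact absurd rfl hyz
  · exact Or.inr (cyclicOrder3_of_lt_minimalPeriod hj h hi')

end CyclicOrder

section NeighborCyclicOrder

variable [Fintype V] [DecidableEq V] {G : SimpleGraph V} [DecidableRel G.Adj]

/-- The distinct neighbours `x`, `y`, `z` of `v` occur in this cyclic order around `v`. -/
def NeighborCyclic (R : RibbonStructure G) (v x y z : V) : Prop :=
  x ≠ z ∧ ∃ e₁ e₂ e₃ : G.Dart, e₁.toProd = (v, x) ∧ e₂.toProd = (v, y) ∧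
    e₃.toProd = (v, z) ∧ CyclicOrder3 R.σ e₁ e₂ e₃

namespace NeighborCyclic

variable {R : RibbonStructure G} {v x y z w : V}

theorem left_ne (h : NeighborCyclic R v x y z) : x ≠ y := by
  obtain ⟨-, e₁, e₂, e₃, h₁, h₂, -, h⟩ := h
  rintro rfl
  exact h.left_ne (SimpleGraph.Dart.ext _ _ (h₁.trans h₂.symm))

theorem rotate (h : NeighborCyclic R v x y z) : NeighborCyclic R v y z x := by
  refine ⟨h.left_ne.symm, ?_⟩
  obtain ⟨hxz, e₁, e₂, e₃, h₁, h₂, h₃, h⟩ := h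
  refine ⟨e₂, e₃, e₁, h₂, h₃, h₁, h.rotate ?_⟩
  rintro rfl
  simp_all

theorem trans (h : NeighborCyclic R v x y z) (h' : NeighborCyclic R v x z w) :
    NeighborCyclic R v x y w := by
  obtain ⟨hxz, e₁, e₂, e₃, h₁, h₂, h₃, h⟩ := h
  obtain ⟨hxw, e₁', e₃', e₄, h₁', h₃', h₄, h'⟩ := h'
  obtain rfl : e₁ = e₁' := SimpleGraph.Dart.ext _ _ (h₁.trans h₁'.symm)
  obtain rfl : e₃ = e₃' := SimpleGraph.Dart.ext _ _ (h₃.trans h₃'.symm)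
  refine ⟨hxw, e₁, e₂, e₄, h₁, h₂, h₄, h.trans ?_ h' ?_⟩ <;> rintro rfl <;> simp_all

theorem trans' (h : NeighborCyclic R v x y z) (h' : NeighborCyclic R v x z w) :
    NeighborCyclic R v y z w :=
  (h'.rotate.trans h.rotate.rotate).rotate.rotate

theorem total (hx : G.Adj v x) (hy : G.Adj v y) (hz : G.Adj v z)
    (hxy : x ≠ y) (hxz : x ≠ z) (hyz : y ≠ z) :
    NeighborCyclic R v x y z ∨ NeighborCyclic R v x z y := by
  let e₁ : G.Dart := ⟨(v, x), hx⟩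
  let e₂ : G.Dart := ⟨(v, y), hy⟩
  let e₃ : G.Dart := ⟨(v, z), hz⟩
  rcases cyclicOrder3_total (R.single_cycle e₁ e₂ rfl) (R.single_cycle e₁ e₃ rfl)
    (by simpa [e₁, e₂] using hxy) (by simpa [e₁, e₃] using hxz)
    (by simpa [e₂, e₃] using hyz) with h | h
  · exact Or.inl ⟨hxz, e₁, e₂, e₃, rfl, rfl, rfl, h⟩
  · exact Or.inr ⟨hxy, e₁, e₃, e₂, rfl, rfl, rfl, h⟩

end NeighborCyclic

theorem mem_betweenHeads_iff {R : RibbonStructure G} {c x y z : V} (hxz : x ≠ z) :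
    y ∈ betweenHeads G R c x z ↔ NeighborCyclic R c x y z := by
  constructor
  · rintro ⟨e₁, e₂, e, h₁, h₂, h, rfl⟩
    refine ⟨hxz, e₁, e, e₂, h₁, ?_, h₂, h⟩
    obtain ⟨i, j, -, -, hi, -⟩ := h
    have htail : ∀ n : ℕ, ((R.σ ^ n) e₁).toProd.1 = e₁.toProd.1 := by
      intro n
      induction n with
      | zero => rfl
      | succ n ih => rw [pow_succ', Equiv.Perm.mul_apply, R.tail_eq, ih]
    ext1
    · rw [← hi, htail, h₁]
    · rfl
  · rintro ⟨-, e₁, e₂, e₃, h₁, h₂, h₃, h⟩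
    exact ⟨e₁, e₃, e₂, h₁, h₃, h, by rw [h₂]⟩

theorem betweenHeads_ssubset_left {R : RibbonStructure G} {c x y z : V}
    (h : NeighborCyclic R c x y z) : betweenHeads G R c x y ⊂ betweenHeads G R c x z := by
  refine (Set.ssubset_iff_of_subset fun t ht => ?_).2
    ⟨y, (mem_betweenHeads_iff h.1).2 h, fun hy => ?_⟩
  · exact (mem_betweenHeads_iff h.1).2 (((mem_betweenHeads_iff h.left_ne).1 ht).trans h)
  · exact ((mem_betweenHeads_iff h.left_ne).1 hy).rotate.left_ne rfl

theorem betweenHeads_ssubset_right {R : RibbonStructure G} {c x y z : V}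
    (h : NeighborCyclic R c x y z) : betweenHeads G R c y z ⊂ betweenHeads G R c x z := by
  have hyz := h.rotate.left_ne
  refine (Set.ssubset_iff_of_subset fun t ht => ?_).2
    ⟨y, (mem_betweenHeads_iff h.1).2 h, fun hy => ?_⟩
  · exact (mem_betweenHeads_iff h.1).2
      (h.rotate.rotate.trans ((mem_betweenHeads_iff hyz).1 ht).rotate.rotate).rotate
  · exact ((mem_betweenHeads_iff hyz).1 hy).left_ne rfl

end NeighborCyclicOrder

section PathList

variable {G : SimpleGraph V} {c b w : V} {A B : List V}

/-- `A` lists the internal vertices of a path of `G` from `c` to `b`. -/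
def IsPathList (G : SimpleGraph V) (c b : V) (A : List V) : Prop :=
  (c :: (A ++ [b])).IsChain G.Adj ∧ (c :: (A ++ [b])).Nodup

namespace IsPathList

theorem reverse (h : IsPathList G c b A) : IsPathList G b c A.reverse := by
  have he : b :: (A.reverse ++ [c]) = (c :: (A ++ [b])).reverse := by simp
  refine ⟨?_, ?_⟩
  · rw [he, List.isChain_reverse]
    exact h.1.imp fun _ _ => SimpleGraph.Adj.symm
  · rw [he, List.nodup_reverse]
    exact h.2

theorem adj_head (h : IsPathList G c b A) : G.Adj c (A.headD b) := by
  cases A <;> simp_all [IsPathList]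

theorem adj_last (h : IsPathList G c b A) : G.Adj b (A.getLastD c) := by
  simpa using h.reverse.adj_head

theorem append (h : IsPathList G c w A) (h' : IsPathList G w b B) (hcb : c ≠ b)
    (hcB : c ∉ B) (hbA : b ∉ A) (hAB : A.Disjoint B) :
    IsPathList G c b (A ++ w :: B) := by
  constructor
  · have := h.1.append_overlap (l₁ := c :: A) (l₂ := [w]) (l₃ := B ++ [b])
      (by simpa using h'.1) (by simp)
    simpa using this
  · have h₁ := h.2
    have h₂ := h'.2
    simp only [List.Disjoint] at hAB
    simp only [List.nodup_cons, List.nodup_append, List.mem_append, List.mem_cons] at *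
    grind

theorem split (h : IsPathList G c b (A ++ w :: B)) :
    IsPathList G c w A ∧ IsPathList G w b B := by
  obtain ⟨h₁, h₂⟩ := h
  constructor
  · have he : c :: (A ++ w :: B ++ [b]) = (c :: (A ++ [w])) ++ (B ++ [b]) := by simp
    rw [he] at h₁ h₂
    exact ⟨h₁.left_of_append, h₂.of_append_left⟩
  · have he : c :: (A ++ w :: B ++ [b]) = (c :: A) ++ (w :: (B ++ [b])) := by simp
    rw [he] at h₁ h₂
    exact ⟨h₁.right_of_append, h₂.of_append_right⟩

/-- Two internally disjoint paths with a common end and a common first step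
are both the single edge between their ends. -/
theorem eq_nil_of_head_eq (hA : IsPathList G c b A) (hB : IsPathList G c b B)
    (hAB : A.Disjoint B) (h : A.headD b = B.headD b) : A = [] ∧ B = [] := by
  have h₁ := hA.2
  have h₂ := hB.2
  cases A <;> cases B <;> simp_all [List.Disjoint]

/-- Two internally disjoint paths with a common end and different first steps
have different last steps. -/
theorem last_ne_of_head_ne (hA : IsPathList G c b A) (hB : IsPathList G c b B)
    (hAB : A.Disjoint B) (h : A.headD b ≠ B.headD b) : A.getLastD c ≠ B.getLastD c := by
  intro he
  obtain ⟨h₁, h₂⟩ := eq_nil_of_head_eq hA.reverse hB.reverse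
    (by simpa [List.Disjoint] using hAB) (by simpa using he)
  exact h (by rw [List.reverse_eq_nil_iff.1 h₁, List.reverse_eq_nil_iff.1 h₂])

end IsPathList

theorem List.headD_append_cons {α : Type*} (l T : List α) (v d : α) :
    (l ++ v :: T).headD d = l.headD v := by
  cases l <;> rfl

theorem List.getLastD_append_cons {α : Type*} (l T : List α) (v d : α) :
    (l ++ v :: T).getLastD d = T.getLastD v := by
  simp [List.getLastD_eq_getLast?, List.getLast?_append, List.getLast?_cons]

theorem headV_eq_headD {n : ℕ} (s : Fin n → V) (b : V) :
    headV s b = (List.ofFn s).headD b := by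
  cases n <;> simp [headV]

theorem lastV_eq_getLastD {n : ℕ} (s : Fin n → V) (c : V) :
    lastV s c = (List.ofFn s).getLastD c := by
  cases n with
  | zero => simp [lastV]
  | succ n =>
    rw [List.ofFn_succ']
    simp [lastV, Fin.last]

theorem isPathSeq_iff {n : ℕ} {c b : V} {s : Fin n → V} :
    IsPathSeq G c b s ↔ IsPathList G c b (List.ofFn s) := Iff.rfl

theorem List.exists_eq_append_cons_of_mem {S : Set V} {l : List V} {u : V} (hu : u ∈ l)
    (huS : u ∈ S) : ∃ Q w T, l = Q ++ w :: T ∧ w ∈ S ∧ ∀ q ∈ Q, q ∉ S := by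
  induction l with
  | nil => simp at hu
  | cons y l ih =>
    by_cases hy : y ∈ S
    · exact ⟨[], y, l, rfl, hy, by simp⟩
    · have hul : u ∈ l := by
        rcases List.mem_cons.1 hu with rfl | h
        · exact absurd huS hy
        · exact h
      obtain ⟨Q, w, T, rfl, hw, hQ⟩ := ih hul
      exact ⟨y :: Q, w, T, rfl, hw, by simpa [hy] using hQ⟩

/-- A neighbour `x` of `c` joined to `u ∈ S` in the complement of `c` is the first vertex of a
path that starts at `c` and stops at its first vertex in `S`. -/
theorem exists_isPathList_of_reachable {S : Set V} {u x : V} (hu : u ≠ c) (hx : x ≠ c)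
    (huS : u ∈ S) (hcx : G.Adj c x)
    (h : (G.induce {v : V | v ≠ c}).Reachable ⟨u, hu⟩ ⟨x, hx⟩) :
    ∃ Q w, IsPathList G c w Q ∧ Q.headD w = x ∧ w ∈ S ∧ ∀ q ∈ Q, q ∉ S := by
  classical
  obtain ⟨p, hp⟩ := h.symm.exists_isPath
  obtain ⟨y, l, hl⟩ : ∃ y l, p.support.map Subtype.val = y :: l := by
    cases p <;> simp
  have hhead : y = x := by
    cases p <;> simp_all
  have hchain : (p.support.map Subtype.val).IsChain G.Adj := by
    rw [List.isChain_map]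
    exact p.isChain_adj_support.imp fun _ _ => id
  have hnodup : (p.support.map Subtype.val).Nodup :=
    hp.support_nodup.map Subtype.val_injective
  have hc : c ∉ p.support.map Subtype.val := by simp
  have hmem : u ∈ p.support.map Subtype.val :=
    List.mem_map.2 ⟨_, p.end_mem_support, rfl⟩
  obtain ⟨Q, w, T, hQ, hw, hQS⟩ := List.exists_eq_append_cons_of_mem hmem huS
  have hxQ : Q.headD w = x := by
    rw [hl] at hQ
    cases Q <;> simp_all
  have he : Q ++ w :: T = (Q ++ [w]) ++ T := by simp
  rw [hQ, he] at hchain hnodup hc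
  refine ⟨Q, w, ⟨?_, ?_⟩, hxQ, hw, hQS⟩
  · refine hchain.left_of_append.cons ?_
    cases Q <;> simp_all
  · exact List.nodup_cons.2 ⟨fun h => hc (List.mem_append_left _ h), hnodup.of_append_left⟩

end PathList

section TypeI

variable [Fintype V] [DecidableEq V] {G : SimpleGraph V} [DecidableRel G.Adj]

/-- The lists `A`, `D`, `F` are the internal vertices of the paths of a type I configuration. -/
structure IsTypeI (R : RibbonStructure G) (c b : V) (A D F : List V) : Prop where
  pathA : IsPathList G c b A
  pathD : IsPathList G c b D
  pathF : IsPathList G c b F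
  disjAD : A.Disjoint D
  disjAF : A.Disjoint F
  disjDF : D.Disjoint F
  cyclic_left : NeighborCyclic R c (A.headD b) (D.headD b) (F.headD b)
  cyclic_right : NeighborCyclic R b (A.getLastD c) (D.getLastD c) (F.getLastD c)

theorem TypeIConfig.isTypeI {R : RibbonStructure G} (K : TypeIConfig G R) :
    IsTypeI R K.c K.b (List.ofFn K.a) (List.ofFn K.d) (List.ofFn K.f) := by
  have hAF : (List.ofFn K.a).Disjoint (List.ofFn K.f) := by
    simpa [List.Disjoint, List.mem_ofFn] using fun i j h => K.disj_af i j h.symm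
  obtain ⟨e₁, e₂, e₃, h₁, h₂, h₃, h⟩ := K.cyc_c
  obtain ⟨g₁, g₂, g₃, k₁, k₂, k₃, k⟩ := K.cyc_b
  simp only [headV_eq_headD] at h₁ h₂ h₃
  simp only [lastV_eq_getLastD] at k₁ k₂ k₃
  have hlast : (List.ofFn K.f).getLastD K.c ≠ (List.ofFn K.a).getLastD K.c := fun he =>
    k.left_ne (SimpleGraph.Dart.ext _ _ (by rw [k₁, k₂, he]))
  have hhead : (List.ofFn K.a).headD K.b ≠ (List.ofFn K.f).headD K.b := by
    intro he
    obtain ⟨hA, hF⟩ := IsPathList.eq_nil_of_head_eq K.path_a K.path_f hAF he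
    exact hlast (by rw [hA, hF])
  have hDF : (List.ofFn K.d).Disjoint (List.ofFn K.f) := by
    simpa [List.Disjoint, List.mem_ofFn] using fun i j h => K.disj_df i j h.symm
  have hg : g₁ ≠ g₃ := by
    rintro rfl
    refine IsPathList.last_ne_of_head_ne K.path_d K.path_f hDF
      (fun he => h.right_ne (SimpleGraph.Dart.ext _ _ (by rw [h₂, h₃, he]))) ?_
    simpa using k₃.symm.trans k₁
  refine ⟨K.path_a, K.path_d, K.path_f, ?_, hAF, hDF, ⟨hhead, e₁, e₂, e₃, h₁, h₂, h₃, h⟩,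
    ⟨?_, g₂, g₃, g₁, k₂, k₃, k₁, k.rotate hg⟩⟩
  · simpa [List.Disjoint, List.mem_ofFn] using fun i j h => K.disj_ad i j h.symm
  · exact hlast.symm

/-- The type I configuration given by three lists of internal vertices. -/
def IsTypeI.toConfig {R : RibbonStructure G} {c b : V} {A D F : List V}
    (h : IsTypeI R c b A D F) : TypeIConfig G R where
  c := c
  b := b
  n := A.length
  m := D.length
  k := F.length
  a := A.get
  d := D.get
  f := F.get
  path_a := by simpa [isPathSeq_iff] using h.pathA
  path_d := by simpa [isPathSeq_iff] using h.pathD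
  path_f := by simpa [isPathSeq_iff] using h.pathF
  disj_ad i j he := h.disjAD (A.get_mem i) (he ▸ D.get_mem j)
  disj_af i j he := h.disjAF (A.get_mem i) (he ▸ F.get_mem j)
  disj_df i j he := h.disjDF (D.get_mem i) (he ▸ F.get_mem j)
  cyc_c := by simpa only [headV_eq_headD, List.ofFn_get] using h.cyclic_left.2
  cyc_b := by simpa only [lastV_eq_getLastD, List.ofFn_get] using h.cyclic_right.rotate.rotate.2

/-- A path that leaves `c` between the first two paths of a type I configuration and returns to
the configuration yields a type I configuration with fewer darts between its first two paths. -/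
theorem IsTypeI.exists_betweenHeads_ssubset {R : RibbonStructure G} {c b w : V}
    {A D F Q : List V} (h : IsTypeI R c b A D F) (hQ : IsPathList G c w Q)
    (hx : NeighborCyclic R c (A.headD b) (Q.headD w) (D.headD b))
    (hw : w ∈ b :: (A ++ D ++ F)) (hQS : ∀ q ∈ Q, q ∉ b :: (A ++ D ++ F)) :
    ∃ c' b' A' D' F', IsTypeI R c' b' A' D' F' ∧
      (betweenHeads G R c' (A'.headD b') (D'.headD b')).ncard <
        (betweenHeads G R c (A.headD b) (D.headD b)).ncard := by
  have hbQ : b ∉ Q := fun hb => hQS b hb (by simp)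
  have hQA : Q.Disjoint A := fun q hq hqA => hQS q hq (by simp [hqA])
  have hQD : Q.Disjoint D := fun q hq hqD => hQS q hq (by simp [hqD])
  have hQF : Q.Disjoint F := fun q hq hqF => hQS q hq (by simp [hqF])
  have hAnd := h.pathA.2
  have hDnd := h.pathD.2
  have hFnd := h.pathF.2
  have hcb : c ≠ b := by rintro rfl; simp at hAnd
  have hcA : c ∉ A := by intro hc; simp [hc] at hAnd
  have hcD : c ∉ D := by intro hc; simp [hc] at hDnd
  have hcF : c ∉ F := by intro hc; simp [hc] at hFnd
  have hleft := Set.ncard_lt_ncard (betweenHeads_ssubset_left hx)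
  have hright := Set.ncard_lt_ncard (betweenHeads_ssubset_right hx)
  have hxF : NeighborCyclic R c (A.headD b) (Q.headD w) (F.headD b) := hx.trans h.cyclic_left
  have hxDF : NeighborCyclic R c (Q.headD w) (D.headD b) (F.headD b) := hx.trans' h.cyclic_left
  simp only [List.mem_cons, List.mem_append] at hw
  rcases hw with rfl | (hw | hw) | hw
  · rcases NeighborCyclic.total (R := R) h.pathA.adj_last hQ.adj_last h.pathF.adj_last
      (hQ.last_ne_of_head_ne h.pathA hQA hx.left_ne.symm).symm h.cyclic_right.1
      (hQ.last_ne_of_head_ne h.pathF hQF hxF.rotate.left_ne) with hb | hb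
    · exact ⟨c, w, A, Q, F, ⟨h.pathA, hQ, h.pathF, hQA.symm, h.disjAF, hQF, hxF, hb⟩, hleft⟩
    · exact ⟨c, w, Q, D, F, ⟨hQ, h.pathD, h.pathF, hQD, hQF, h.disjDF, hxDF,
        (h.cyclic_right.trans' hb).rotate.rotate⟩, hright⟩
  · obtain ⟨A₁, A₂, rfl⟩ := List.append_of_mem hw
    refine ⟨c, b, Q ++ w :: A₂, D, F, ⟨hQ.append h.pathA.split.2 hcb (by simp_all) hbQ
      (by simp_all [List.Disjoint]), h.pathD, h.pathF, ?_, ?_, h.disjDF, ?_, ?_⟩, ?_⟩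
    · have := h.disjAD
      simp_all [List.Disjoint]
      grind
    · have := h.disjAF
      simp_all [List.Disjoint]
      grind
    · rwa [List.headD_append_cons]
    · simpa only [List.getLastD_append_cons] using h.cyclic_right
    · rwa [List.headD_append_cons Q]
  · obtain ⟨D₁, D₂, rfl⟩ := List.append_of_mem hw
    refine ⟨c, b, A, Q ++ w :: D₂, F, ⟨h.pathA, hQ.append h.pathD.split.2 hcb (by simp_all) hbQ
      (by simp_all [List.Disjoint]), h.pathF, ?_, h.disjAF, ?_, ?_, ?_⟩, ?_⟩
    · have := h.disjAD
      simp_all [List.Disjoint]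
      grind
    · have := h.disjDF
      simp_all [List.Disjoint]
      grind
    · rwa [List.headD_append_cons]
    · simpa only [List.getLastD_append_cons] using h.cyclic_right
    · rwa [List.headD_append_cons Q]
  · obtain ⟨F₁, F₂, rfl⟩ := List.append_of_mem hw
    obtain ⟨hF₁, hF₂⟩ := h.pathF.split
    rw [List.headD_append_cons] at hxF hxDF
    have hAF := h.disjAF
    have hDF := h.disjDF
    have hQl : Q.getLastD c ∈ c :: Q := List.getLastD_mem_cons
    have hF₁l : F₁.getLastD c ∈ c :: F₁ := List.getLastD_mem_cons
    have hF₂h : F₂.headD b ∈ F₂ ++ [b] := by cases F₂ <;> simp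
    have hF₂r : F₂.reverse.getLastD b = F₂.headD b := by simp
    have hcw : c ≠ w := by rintro rfl; simp at hcF
    have hQF₁ : Q.Disjoint F₁ := fun q hq hq' => hQF hq (by simp [hq'])
    simp only [List.Disjoint, List.nodup_cons, List.nodup_append, List.mem_append,
      List.mem_cons] at *
    rcases NeighborCyclic.total (R := R) hF₂.adj_head hQ.adj_last hF₁.adj_last (by grind)
      (by grind) (hQ.last_ne_of_head_ne hF₁ hQF₁ hxF.rotate.left_ne) with hw' | hw'
    · refine ⟨c, w, A ++ b :: F₂.reverse, Q, F₁, ⟨h.pathA.append hF₂.reverse hcw ?_ ?_ ?_, hQ,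
        hF₁, ?_, ?_, ?_, ?_, ?_⟩, ?_⟩
      · grind
      · grind
      · grind [List.Disjoint]
      · grind [List.Disjoint]
      · grind [List.Disjoint]
      · grind [List.Disjoint]
      · rwa [List.headD_append_cons]
      · rwa [List.getLastD_append_cons, hF₂r]
      · rwa [List.headD_append_cons]
    · refine ⟨c, w, Q, D ++ b :: F₂.reverse, F₁, ⟨hQ, h.pathD.append hF₂.reverse hcw ?_ ?_ ?_,
        hF₁, ?_, ?_, ?_, ?_, ?_⟩, ?_⟩
      · grind
      · grind
      · grind [List.Disjoint]
      · grind [List.Disjoint]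
      · grind [List.Disjoint]
      · grind [List.Disjoint]
      · rwa [List.headD_append_cons]
      · rw [List.getLastD_append_cons, hF₂r]
        exact hw'.rotate.rotate
      · rwa [List.headD_append_cons]

theorem IsTypeI.exists_witness {R : RibbonStructure G} {c b : V} {A D F : List V}
    (h : IsTypeI R c b A D F) : ∃ K : TypeIConfig G R, IsTypeAWitness K := by
  induction hN : (betweenHeads G R c (A.headD b) (D.headD b)).ncard using Nat.strong_induction_on
    generalizing c b A D F with
  | _ N ih =>
    subst hN
    by_contra hK
    refine hK ⟨h.toConfig, fun u hu huc x hxc hx hr => ?_⟩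
    simp only [headV_eq_headD, IsTypeI.toConfig, List.ofFn_get] at hx
    have hx' := (mem_betweenHeads_iff h.cyclic_left.left_ne).1 hx
    have hcx : G.Adj c x := by
      obtain ⟨-, -, e, -, -, he, -⟩ := hx'
      have := e.adj
      rwa [he] at this
    have huS : u ∈ b :: (A ++ D ++ F) := by
      simp only [List.mem_cons, List.mem_append]
      rcases hu with hu | ⟨i, rfl⟩ | ⟨i, rfl⟩ | ⟨i, rfl⟩
      · exact Or.inl hu
      · exact Or.inr (Or.inl (Or.inl (A.get_mem i)))
      · exact Or.inr (Or.inl (Or.inr (D.get_mem i)))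
      · exact Or.inr (Or.inr (F.get_mem i))
    obtain ⟨Q, w, hQ, rfl, hw, hQS⟩ :=
      exists_isPathList_of_reachable (S := {v | v ∈ b :: (A ++ D ++ F)}) huc hxc huS hcx hr
    obtain ⟨c', b', A', D', F', h', hlt⟩ := h.exists_betweenHeads_ssubset hQ hx' hw hQS
    exact hK (ih _ hlt h' rfl)

end TypeI

/-- **Lemma (I ⇒ A).** If a non-planar finite connected simple ribbon graph contains a
type I configuration, then it is of type A. -/
theorem typeI_implies_typeA [Fintype V] [DecidableEq V]
    (G : SimpleGraph V) [DecidableRel G.Adj] (hconn : G.Connected)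
    (R : RibbonStructure G) (hnp : ¬ R.IsPlanar)
    (hI : Nonempty (TypeIConfig G R)) :
    ∃ K : TypeIConfig G R, IsTypeAWitness K :=
  hI.elim fun K => K.isTypeI.exists_witness
end
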